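/- There exists a constant C > 0 (depending only on the distributions of ξ and η) such that for all n ≥ 1 (with P(|𝒯| = n) > 0) and all t ∈ [−π, π], E | (1/n) Σ_{j ∈ ℤ} X(j; T_n) e^{ijt} |² ≤ C / (1 + n t⁴), where X(j; T_n) is the number of vertices of T_n whose label equals j. -/

import Mathlib

open scoped ENNReal BigOperators
open Set

/-- Plane (ordered rooted) trees with an integer label on every edge: each child comes
with the label of the edge joining it to its parent. -/
inductive LTree : Type
  | node : List (ℤ × LTree) → LTree

namespace LTree

/-- The labelled subtrees hanging off the root, with the labels of the connecting edges. -/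
def children : LTree → List (ℤ × LTree)
  | .node ts => ts

/-- The labelled subtree rooted at a given position (sequence of child indices). -/
def subtreeAt : LTree → List ℕ → Option LTree
  | t, [] => some t
  | .node ts, i :: q =>
    match ts[i]? with
    | some (_, t') => subtreeAt t' q
    | none => none

/-- The vertex set of a labelled tree, with vertices identified with their positions. -/
def vertexSet (t : LTree) : Set (List ℕ) := {q | (subtreeAt t q).isSome}

/-- The number of vertices of a labelled tree. -/
noncomputable def size (t : LTree) : ℕ := (vertexSet t).ncard

/-- The number of children of the vertex at position `q`. -/
def childCount (t : LTree) (q : List ℕ) : ℕ :=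
  ((subtreeAt t q).map fun t' => t'.children.length).getD 0

/-- The label `L_v` of the vertex at position `q`: the sum of the edge labels along the
path from the root to the vertex.  (The root has label `0`.) -/
def labelAt : LTree → List ℕ → ℤ
  | _, [] => 0
  | .node ts, i :: q =>
    match ts[i]? with
    | some (a, t') => a + labelAt t' q
    | none => 0

/-- The label of the edge between the vertex at (nonempty) position `q` and its parent. -/
def edgeLabel : LTree → List ℕ → ℤ
  | _, [] => 0
  | .node ts, [i] => ((ts[i]?).map Prod.fst).getD 0
  | .node ts, i :: q =>
    match ts[i]? with
    | some (_, t') => edgeLabel t' q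
    | none => 0

end LTree

/-- The probability of a given labelled tree under the Galton–Watson distribution with
offspring distribution `p`, with i.i.d. edge labels distributed as `ν`, independent of
the tree. -/
noncomputable def gwlProb (p : ℕ → ℝ≥0∞) (ν : ℤ → ℝ≥0∞) (t : LTree) : ℝ≥0∞ :=
  (∏ᶠ v ∈ LTree.vertexSet t, p (LTree.childCount t v)) *
    ∏ᶠ v ∈ LTree.vertexSet t \ {[]}, ν (LTree.edgeLabel t v)

/-- `P(|𝒯| = n)` for the labelled Galton–Watson tree. -/
noncomputable def probSizeL (p : ℕ → ℝ≥0∞) (ν : ℤ → ℝ≥0∞) (n : ℕ) : ℝ≥0∞ :=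
  ∑' t : LTree, if LTree.size t = n then gwlProb p ν t else 0

/-- `X(j; t)`: the number of vertices of the labelled tree `t` with label `j`
(the vertical profile). -/
noncomputable def profile (t : LTree) (j : ℤ) : ℕ :=
  {v | v ∈ LTree.vertexSet t ∧ LTree.labelAt t v = j}.ncard

/-- The variance of the offspring distribution `p` (which has mean `1`). -/
noncomputable def xiVar (p : ℕ → ℝ≥0∞) : ℝ≥0∞ :=
  ∑' k : ℕ, p k * ENNReal.ofReal (((k : ℝ) - 1) ^ 2)

/-- The variance of the integer-valued label distribution `ν` (which has mean `0`). -/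
noncomputable def etaVar (ν : ℤ → ℝ≥0∞) : ℝ≥0∞ :=
  ∑' k : ℤ, ν k * ENNReal.ofReal ((k : ℝ) ^ 2)

namespace LTree

theorem induction_on {P : LTree → Prop}
    (h : ∀ ts : List (ℤ × LTree), (∀ x ∈ ts, P x.2) → P (.node ts)) (T : LTree) : P T := by
  refine LTree.rec (motive_1 := P) (motive_2 := fun ts => ∀ x ∈ ts, P x.2)
    (motive_3 := fun x => P x.2) ?_ ?_ ?_ ?_ T
  · exact h
  · simp
  · intro x ts hx hts y hy
    rcases List.mem_cons.1 hy with rfl | hy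
    · exact hx
    · exact hts y hy
  · intro a T hT
    exact hT

theorem nil_mem_vertexSet (T : LTree) : [] ∈ vertexSet T := by
  cases T; simp [vertexSet, subtreeAt]

theorem cons_mem_vertexSet (ts : List (ℤ × LTree)) (i : Fin ts.length) (q : List ℕ) :
    (i : ℕ) :: q ∈ vertexSet (.node ts) ↔ q ∈ vertexSet ts[i].2 := by
  simp [vertexSet, subtreeAt]

theorem vertexSet_node_diff (ts : List (ℤ × LTree)) :
    vertexSet (.node ts) \ {[]} =
      ⋃ i : Fin ts.length, (List.cons (i : ℕ)) '' vertexSet ts[i].2 := by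
  ext q
  rcases q with _ | ⟨i, q⟩
  · simp
  · by_cases hi : i < ts.length
    · have := cons_mem_vertexSet ts ⟨i, hi⟩ q
      simp only [Fin.getElem_fin] at this
      simp only [mem_sdiff, this, mem_iUnion, mem_image, List.cons.injEq]
      constructor
      · rintro ⟨h, -⟩
        exact ⟨⟨i, hi⟩, q, h, rfl, rfl⟩
      · rintro ⟨j, q', h, rfl, rfl⟩
        exact ⟨h, by simp⟩
    · have h1 : i :: q ∉ vertexSet (.node ts) := by
        simp [vertexSet, subtreeAt, List.getElem?_eq_none (not_lt.1 hi)]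
      simp only [mem_sdiff, h1, false_and, mem_iUnion, mem_image, List.cons.injEq, false_iff]
      rintro ⟨j, q', h, rfl, rfl⟩
      exact hi j.2

theorem vertexSet_eq_insert (T : LTree) : vertexSet T = insert [] (vertexSet T \ {[]}) := by
  rw [insert_sdiff_singleton, insert_eq_of_mem (nil_mem_vertexSet T)]

theorem vertexSet_finite (T : LTree) : (vertexSet T).Finite := by
  induction T using induction_on with
  | h ts ih =>
    rw [vertexSet_eq_insert, vertexSet_node_diff]
    exact (finite_iUnion fun i => (ih _ (List.getElem_mem _)).image _).insert _

@[to_additive]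
theorem finprod_vertexSet_node_diff {M : Type*} [CommMonoid M] (ts : List (ℤ × LTree))
    (f : List ℕ → M) : ∏ᶠ v ∈ vertexSet (.node ts) \ {[]}, f v =
      ∏ i : Fin ts.length, ∏ᶠ v ∈ vertexSet ts[i].2, f ((i : ℕ) :: v) := by
  rw [vertexSet_node_diff, finprod_mem_iUnion, finprod_eq_prod_of_fintype]
  · exact Finset.prod_congr rfl fun i _ => finprod_mem_image (by simp [InjOn])
  · intro i j hij
    rw [Function.onFun, disjoint_left]
    rintro _ ⟨q, -, rfl⟩ ⟨q', -, h⟩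
    simp only [List.cons.injEq] at h
    exact hij (Fin.ext h.1.symm)
  · exact fun i => (vertexSet_finite _).image _

@[to_additive]
theorem finprod_vertexSet {M : Type*} [CommMonoid M] (T : LTree) (f : List ℕ → M) :
    ∏ᶠ v ∈ vertexSet T, f v = f [] * ∏ᶠ v ∈ vertexSet T \ {[]}, f v := by
  conv_lhs => rw [vertexSet_eq_insert]
  exact finprod_mem_insert _ (by simp) ((vertexSet_finite T).sdiff)

theorem finsum_vertexSet_node {M : Type*} [AddCommMonoid M] (ts : List (ℤ × LTree))
    (f : List ℕ → M) : ∑ᶠ v ∈ vertexSet (.node ts), f v =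
      f [] + ∑ i : Fin ts.length, ∑ᶠ v ∈ vertexSet ts[i].2, f ((i : ℕ) :: v) := by
  rw [finsum_vertexSet, finsum_vertexSet_node_diff]

/-- The total size of a forest. -/
noncomputable def forestSize (ts : List (ℤ × LTree)) : ℕ := (ts.map fun x => size x.2).sum

theorem size_eq_finsum (T : LTree) : size T = ∑ᶠ v ∈ vertexSet T, 1 := by
  rw [finsum_mem_eq_finite_toFinset_sum _ (vertexSet_finite T), size,
    ncard_eq_toFinset_card _ (vertexSet_finite T), Finset.card_eq_sum_ones]

theorem sum_univ_getElem_snd {M : Type*} [AddCommMonoid M] (ts : List (ℤ × LTree))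
    (f : ℤ × LTree → M) : ∑ i : Fin ts.length, f ts[i] = (ts.map f).sum := by
  rw [← Fin.sum_univ_fun_getElem]; rfl

theorem size_node (ts : List (ℤ × LTree)) : size (.node ts) = 1 + forestSize ts := by
  rw [size_eq_finsum, finsum_vertexSet_node, forestSize,
    ← sum_univ_getElem_snd ts fun x => size x.2]
  simp only [size_eq_finsum]

theorem forestSize_cons (x : ℤ × LTree) (ts : List (ℤ × LTree)) :
    forestSize (x :: ts) = size x.2 + forestSize ts := by
  simp [forestSize]

theorem size_pos (T : LTree) : 0 < size T := by
  cases T; rw [size_node]; omega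

theorem length_le_forestSize (ts : List (ℤ × LTree)) : ts.length ≤ forestSize ts := by
  induction ts with
  | nil => simp
  | cons x ts ih =>
    rw [forestSize_cons, List.length_cons]
    have := size_pos x.2
    omega

/-- The sum of `exp (i t L_v)` over the vertices `v`. -/
noncomputable def charSum (t : ℝ) (T : LTree) : ℂ :=
  ∑ᶠ v ∈ vertexSet T, Complex.exp (Complex.I * labelAt T v * t)

/-- The sum of `exp (i t L_v)` over the non-root vertices of a tree with the given branches. -/
noncomputable def forestCharSum (t : ℝ) (ts : List (ℤ × LTree)) : ℂ :=
  (ts.map fun x => Complex.exp (Complex.I * x.1 * t) * charSum t x.2).sum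

theorem charSum_node (t : ℝ) (ts : List (ℤ × LTree)) :
    charSum t (.node ts) = 1 + forestCharSum t ts := by
  rw [charSum, finsum_vertexSet_node, forestCharSum,
    ← sum_univ_getElem_snd ts fun x => Complex.exp (Complex.I * x.1 * t) * charSum t x.2]
  congr 1
  · simp [labelAt]
  · refine Finset.sum_congr rfl fun i _ => ?_
    rw [charSum, mul_finsum_mem]
    refine finsum_mem_congr rfl fun v _ => ?_
    rw [← Complex.exp_add]
    simp [labelAt]
    ring_nf

theorem norm_charSum_le (t : ℝ) (T : LTree) : ‖charSum t T‖ ≤ size T := by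
  rw [charSum, size, finsum_mem_eq_finite_toFinset_sum _ (vertexSet_finite T),
    ncard_eq_toFinset_card _ (vertexSet_finite T)]
  refine (norm_sum_le _ _).trans (le_of_eq ?_)
  have h : ∀ v, ‖Complex.exp (Complex.I * labelAt T v * t)‖ = 1 := fun v => by
    rw [show Complex.I * labelAt T v * t = ((labelAt T v * t : ℝ) : ℂ) * Complex.I by
      push_cast; ring]
    exact Complex.norm_exp_ofReal_mul_I _
  simp [h]

theorem finsum_profile (t : ℝ) (T : LTree) :
    ∑ᶠ j : ℤ, (profile T j : ℂ) * Complex.exp (Complex.I * j * t) = charSum t T := by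
  classical
  have hV := vertexSet_finite T
  have h1 : ∀ j, profile T j = (hV.toFinset.filter fun v => labelAt T v = j).card := fun j => by
    rw [profile, ← ncard_coe_finset]
    congr 1; ext v; simp
  rw [charSum, finsum_mem_eq_finite_toFinset_sum _ hV,
    finsum_eq_sum_of_support_subset (s := hV.toFinset.image (labelAt T)),
    ← Finset.sum_fiberwise_of_maps_to (g := labelAt T) (t := hV.toFinset.image (labelAt T))
      (fun v hv => Finset.mem_image_of_mem _ hv)]
  · refine Finset.sum_congr rfl fun j _ => ?_
    rw [h1, Finset.sum_congr rfl (g := fun _ => Complex.exp (Complex.I * j * t)) ?_]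
    · simp
    · intro v hv
      rw [(Finset.mem_filter.1 hv).2]
  · intro j hj
    have h2 : profile T j ≠ 0 := by
      intro h; simp [h] at hj
    rw [h1, Finset.card_ne_zero] at h2
    obtain ⟨v, hv⟩ := h2
    rw [Finset.mem_filter] at hv
    simp only [Finset.coe_image, mem_image, Finset.mem_coe]
    exact ⟨v, hv⟩

end LTree

open LTree in
theorem gwlProb_node (p : ℕ → ℝ≥0∞) (ν : ℤ → ℝ≥0∞) (ts : List (ℤ × LTree)) :
    gwlProb p ν (.node ts) = p ts.length * (ts.map fun x => ν x.1 * gwlProb p ν x.2).prod := by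
  have h : (ts.map fun x => ν x.1 * gwlProb p ν x.2).prod =
      ∏ i : Fin ts.length, (ν ts[i].1 * gwlProb p ν ts[i].2) := by
    rw [← Fin.prod_univ_fun_getElem]; rfl
  rw [gwlProb, finprod_vertexSet, finprod_vertexSet_node_diff, finprod_vertexSet_node_diff, h,
    mul_assoc, ← Finset.prod_mul_distrib]
  congr 1
  refine Finset.prod_congr rfl fun i _ => ?_
  have h1 : ∀ v, childCount (.node ts) ((i : ℕ) :: v) = childCount ts[i].2 v := fun v => by
    simp [childCount, subtreeAt]
  rw [finprod_vertexSet _ fun v => ν (edgeLabel (.node ts) ((i : ℕ) :: v)), gwlProb]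
  have h2 : ∏ᶠ v ∈ vertexSet ts[i].2 \ {[]}, ν (edgeLabel (.node ts) ((i : ℕ) :: v)) =
      ∏ᶠ v ∈ vertexSet ts[i].2 \ {[]}, ν (edgeLabel ts[i].2 v) := by
    refine finprod_mem_congr rfl fun v hv => ?_
    rcases v with _ | ⟨j, v⟩
    · simp at hv
    · simp [edgeLabel]
  simp only [h1, h2]
  simp only [edgeLabel]
  simp
  ring

/-- `X` has total weight `q`, first moment of norm at most `A` and second absolute moment at
most `D` with respect to the nonnegative weights `u`. -/
structure MomentBound {α : Type*} (u : α → ℝ) (X : α → ℂ) (q A D : ℝ) : Prop where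
  nonneg : ∀ a, 0 ≤ u a
  hasSum : HasSum u q
  summable_sq : Summable fun a => u a * ‖X a‖ ^ 2
  norm_le : ‖∑' a, (u a : ℂ) * X a‖ ≤ A
  sq_le : ∑' a, u a * ‖X a‖ ^ 2 ≤ D

theorem hasSum_prod_of_nonneg {α β : Type*} {f : α → ℝ} {g : β → ℝ} {s t : ℝ} (hf : HasSum f s)
    (hg : HasSum g t) (hf0 : ∀ a, 0 ≤ f a) (hg0 : ∀ b, 0 ≤ g b) :
    HasSum (fun z : α × β => f z.1 * g z.2) (s * t) :=
  hf.mul hg (hf.summable.mul_of_nonneg hg.summable hf0 hg0)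

theorem hasSum_prod_of_summable_norm {α β : Type*} {f : α → ℂ} {g : β → ℂ} {s t : ℂ}
    (hf : HasSum f s) (hg : HasSum g t) (hf0 : Summable fun a => ‖f a‖)
    (hg0 : Summable fun b => ‖g b‖) :
    HasSum (fun z : α × β => f z.1 * g z.2) (s * t) :=
  hf.mul hg (summable_mul_of_summable_norm hf0 hg0)

namespace MomentBound

variable {α β : Type*} {u : α → ℝ} {X : α → ℂ} {q A D : ℝ} {v : β → ℝ} {Y : β → ℂ} {q' A' D' : ℝ}

theorem summable_norm_mul (h : MomentBound u X q A D) : Summable fun a => ‖(u a : ℂ) * X a‖ := by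
  refine Summable.of_nonneg_of_le (fun _ => norm_nonneg _) (fun a => ?_)
    (h.hasSum.summable.add h.summable_sq)
  rw [norm_mul, Complex.norm_real, Real.norm_of_nonneg (h.nonneg a)]
  nlinarith [h.nonneg a, mul_nonneg (h.nonneg a) (sq_nonneg (‖X a‖ - 1)),
    mul_nonneg (h.nonneg a) (sq_nonneg (‖X a‖))]

theorem summable_norm_weight (h : MomentBound u X q A D) : Summable fun a => ‖(u a : ℂ)‖ := by
  simpa [abs_of_nonneg (h.nonneg _)] using h.hasSum.summable

theorem mass_nonneg (h : MomentBound u X q A D) : 0 ≤ q :=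
  h.hasSum.nonneg h.nonneg

theorem bound_nonneg (h : MomentBound u X q A D) : 0 ≤ A :=
  (norm_nonneg _).trans h.norm_le

theorem zero : MomentBound (fun _ : α => 0) X 0 0 0 :=
  ⟨fun _ => le_rfl, hasSum_zero, by simp, by simp, by simp⟩

theorem smul (h : MomentBound u X q A D) {c : ℝ} (hc : 0 ≤ c) :
    MomentBound (fun a => c * u a) X (c * q) (c * A) (c * D) := by
  refine ⟨fun a => mul_nonneg hc (h.nonneg a), h.hasSum.mul_left c, ?_, ?_, ?_⟩
  · simpa [mul_assoc] using h.summable_sq.mul_left c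
  · simp only [Complex.ofReal_mul, mul_assoc, tsum_mul_left, norm_mul, Complex.norm_real,
      Real.norm_of_nonneg hc]
    exact mul_le_mul_of_nonneg_left h.norm_le hc
  · simp only [mul_assoc, tsum_mul_left]
    exact mul_le_mul_of_nonneg_left h.sq_le hc

theorem add {w : α → ℝ} (h : MomentBound u X q A D) (h' : MomentBound w X q' A' D') :
    MomentBound (fun a => u a + w a) X (q + q') (A + A') (D + D') := by
  refine ⟨fun a => add_nonneg (h.nonneg a) (h'.nonneg a), h.hasSum.add h'.hasSum, ?_, ?_, ?_⟩
  · simpa [add_mul] using h.summable_sq.add h'.summable_sq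
  · simp only [Complex.ofReal_add, add_mul]
    rw [(h.summable_norm_mul.of_norm).tsum_add h'.summable_norm_mul.of_norm]
    exact (norm_add_le _ _).trans (add_le_add h.norm_le h'.norm_le)
  · simp only [add_mul]
    rw [h.summable_sq.tsum_add h'.summable_sq]
    exact add_le_add h.sq_le h'.sq_le

theorem sum {ι : Type*} (s : Finset ι) {u : ι → α → ℝ} {q A D : ι → ℝ}
    (h : ∀ i ∈ s, MomentBound (u i) X (q i) (A i) (D i)) :
    MomentBound (fun a => ∑ i ∈ s, u i a) X (∑ i ∈ s, q i) (∑ i ∈ s, A i) (∑ i ∈ s, D i) := by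
  classical
  induction s using Finset.induction_on with
  | empty => simpa using zero
  | insert i s hi ih =>
    simp only [Finset.sum_insert hi]
    exact (h i (Finset.mem_insert_self _ _)).add
      (ih fun j hj => h j (Finset.mem_insert_of_mem hj))

theorem hasSum_ofReal (h : MomentBound u X q A D) : HasSum (fun a => (u a : ℂ)) q :=
  Complex.hasSum_ofReal.2 h.hasSum

theorem prod (h : MomentBound u X q A D) (h' : MomentBound v Y q' A' D') :
    MomentBound (fun z : α × β => u z.1 * v z.2) (fun z => X z.1 + Y z.2) (q * q')
      (A * q' + q * A') (D * q' + q * D' + 2 * (A * A')) := by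
  have hux := h.summable_norm_mul
  have hvy := h'.summable_norm_mul
  have e1 : HasSum (fun z : α × β => (u z.1 * v z.2 : ℝ)) (q * q') :=
    hasSum_prod_of_nonneg h.hasSum h'.hasSum h.nonneg h'.nonneg
  have e2 := hasSum_prod_of_summable_norm hux.of_norm.hasSum h'.hasSum_ofReal hux
    h'.summable_norm_weight
  have e3 := hasSum_prod_of_summable_norm h.hasSum_ofReal hvy.of_norm.hasSum
    h.summable_norm_weight hvy
  have hsu : ∀ a, 0 ≤ u a * ‖X a‖ ^ 2 := fun a => mul_nonneg (h.nonneg a) (sq_nonneg _)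
  have hsv : ∀ a, 0 ≤ v a * ‖Y a‖ ^ 2 := fun a => mul_nonneg (h'.nonneg a) (sq_nonneg _)
  have e4 := hasSum_prod_of_nonneg h.summable_sq.hasSum h'.hasSum hsu h'.nonneg
  have e5 := hasSum_prod_of_nonneg h.hasSum h'.summable_sq.hasSum h.nonneg hsv
  have hvy' : Summable fun b => ‖(starRingEnd ℂ) ((v b : ℂ) * Y b)‖ := by simpa using hvy
  have e6 := hasSum_prod_of_summable_norm hux.of_norm.hasSum hvy'.of_norm.hasSum hux hvy'
  rw [← Complex.conj_tsum] at e6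
  have e7 := (Complex.hasSum_re e6).mul_left 2
  have e8 := ((e4.add e5).add e7).congr_fun
    (g := fun z : α × β => u z.1 * v z.2 * ‖X z.1 + Y z.2‖ ^ 2) fun z => by
    simp only [← Complex.normSq_eq_norm_sq, Complex.normSq_add]
    simp only [map_mul, Complex.conj_ofReal]
    rw [show (u z.1 : ℂ) * X z.1 * ((v z.2 : ℂ) * (starRingEnd ℂ) (Y z.2)) =
      ((u z.1 * v z.2 : ℝ) : ℂ) * (X z.1 * (starRingEnd ℂ) (Y z.2)) by push_cast; ring,
      Complex.re_ofReal_mul]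
    ring
  refine ⟨fun z => mul_nonneg (h.nonneg _) (h'.nonneg _), e1, e8.summable, ?_, ?_⟩
  · have e9 : HasSum (fun z : α × β => ((u z.1 * v z.2 : ℝ) : ℂ) * (X z.1 + Y z.2)) _ :=
      (e2.add e3).congr_fun fun z => by push_cast; ring
    rw [e9.tsum_eq]
    refine (norm_add_le _ _).trans ?_
    simp only [norm_mul, Complex.norm_real, Real.norm_of_nonneg h.mass_nonneg,
      Real.norm_of_nonneg h'.mass_nonneg]
    exact add_le_add (mul_le_mul_of_nonneg_right h.norm_le h'.mass_nonneg)
      (mul_le_mul_of_nonneg_left h'.norm_le h.mass_nonneg)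
  · rw [e8.tsum_eq]
    refine add_le_add (add_le_add (mul_le_mul_of_nonneg_right h.sq_le h'.mass_nonneg)
      (mul_le_mul_of_nonneg_left h'.sq_le h.mass_nonneg)) (mul_le_mul_of_nonneg_left ?_ two_pos.le)
    refine (Complex.re_le_norm _).trans ?_
    rw [norm_mul, RCLike.norm_conj]
    exact mul_le_mul h.norm_le h'.norm_le (norm_nonneg _) h.bound_nonneg

theorem rotate (h : MomentBound u X q A D) {w : β → ℝ} (hw0 : ∀ b, 0 ≤ w b) (hw : HasSum w 1)
    {e : β → ℂ} (he : ∀ b, ‖e b‖ = 1) :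
    MomentBound (fun z : β × α => w z.1 * u z.2) (fun z => e z.1 * X z.2) q
      (‖∑' b, (w b : ℂ) * e b‖ * A) D := by
  have hwe : Summable fun b => ‖(w b : ℂ) * e b‖ := by
    simpa [he, abs_of_nonneg (hw0 _)] using hw.summable
  have e1 := hasSum_prod_of_nonneg hw h.hasSum hw0 h.nonneg
  have hsu : ∀ a, 0 ≤ u a * ‖X a‖ ^ 2 := fun a => mul_nonneg (h.nonneg a) (sq_nonneg _)
  have e2 := hasSum_prod_of_nonneg hw h.summable_sq.hasSum hw0 hsu
  have e3 := hasSum_prod_of_summable_norm hwe.of_norm.hasSum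
    h.summable_norm_mul.of_norm.hasSum hwe h.summable_norm_mul
  have e4 : HasSum (fun z : β × α => w z.1 * u z.2 * ‖e z.1 * X z.2‖ ^ 2) _ :=
    e2.congr_fun fun z => by rw [norm_mul, he]; ring
  have e5 : HasSum (fun z : β × α => ((w z.1 * u z.2 : ℝ) : ℂ) * (e z.1 * X z.2)) _ :=
    e3.congr_fun fun z => by push_cast; ring
  refine ⟨fun z => mul_nonneg (hw0 _) (h.nonneg _), by simpa using e1, e4.summable, ?_, ?_⟩
  · rw [e5.tsum_eq, norm_mul]
    exact mul_le_mul_of_nonneg_left h.norm_le (norm_nonneg _)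
  · rw [e4.tsum_eq, one_mul]
    exact h.sq_le

theorem one_add (h : MomentBound u X q A D) :
    MomentBound u (fun a => 1 + X a) q (q + A) (q + 2 * A + D) := by
  have e1 := h.summable_norm_mul.of_norm.hasSum
  have e2 : HasSum (fun a => (u a : ℂ) * (1 + X a)) _ :=
    (h.hasSum_ofReal.add e1).congr_fun fun a => by ring
  have e3 : HasSum (fun a => u a * ‖1 + X a‖ ^ 2) _ :=
    ((h.hasSum.add ((Complex.hasSum_re e1).mul_left 2)).add h.summable_sq.hasSum).congr_fun
      fun a => by
        simp only [← Complex.normSq_eq_norm_sq, Complex.normSq_add, Complex.re_ofReal_mul]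
        simp
        ring
  refine ⟨h.nonneg, h.hasSum, e3.summable, ?_, ?_⟩
  · rw [e2.tsum_eq]
    refine (norm_add_le _ _).trans (add_le_add ?_ h.norm_le)
    rw [Complex.norm_real, Real.norm_of_nonneg h.mass_nonneg]
  · rw [e3.tsum_eq]
    refine add_le_add (add_le_add le_rfl (mul_le_mul_of_nonneg_left ?_ two_pos.le)) h.sq_le
    exact (Complex.re_le_norm _).trans h.norm_le

theorem of_comp {g : β → α} (hg : Function.Injective g) (hu : ∀ a ∉ range g, u a = 0)
    (h : MomentBound (fun b => u (g b)) (fun b => X (g b)) q A D) : MomentBound u X q A D := by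
  have hu1 : ∀ a ∉ range g, (u a : ℂ) * X a = 0 := fun a ha => by simp [hu a ha]
  have hu2 : ∀ a ∉ range g, u a * ‖X a‖ ^ 2 = 0 := fun a ha => by simp [hu a ha]
  have e2 := (hg.hasSum_iff hu1).1 h.summable_norm_mul.of_norm.hasSum
  have e3 := (hg.hasSum_iff hu2).1 h.summable_sq.hasSum
  refine ⟨fun a => ?_, (hg.hasSum_iff hu).1 h.hasSum, e3.summable, ?_, ?_⟩
  · by_cases ha : a ∈ range g
    · obtain ⟨b, rfl⟩ := ha
      exact h.nonneg b
    · rw [hu a ha]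
  · rw [e2.tsum_eq]; exact h.norm_le
  · rw [e3.tsum_eq]; exact h.sq_le

end MomentBound

open PowerSeries in
theorem PowerSeries.coeff_pow_eq_zero_of_lt {y : PowerSeries ℝ} (hy : constantCoeff y = 0)
    {n k : ℕ} (h : n < k) : coeff n (y ^ k) = 0 :=
  coeff_of_lt_order _ ((Nat.cast_lt.2 h).trans_le (le_order_pow_of_constantCoeff_eq_zero k hy))

open PowerSeries in
theorem PowerSeries.coeff_subst_eq_sum {y : PowerSeries ℝ} (hy : constantCoeff y = 0)
    (f : PowerSeries ℝ) {n N : ℕ} (h : n < N) :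
    coeff n (f.subst y) = ∑ k ∈ Finset.range N, coeff k f * coeff n (y ^ k) := by
  rw [coeff_subst' (HasSubst.of_constantCoeff_zero' hy),
    finsum_eq_sum_of_support_subset (s := Finset.range N)]
  · simp [smul_eq_mul]
  · intro k hk
    simp only [Finset.coe_range, mem_Iio]
    by_contra hkN
    exact hk (by simp [coeff_pow_eq_zero_of_lt hy (h.trans_le (not_lt.1 hkN))])

open PowerSeries in
theorem PowerSeries.coeff_subst_mul_eq_sum {y : PowerSeries ℝ} (hy : constantCoeff y = 0)
    (f g : PowerSeries ℝ) {n N : ℕ} (h : n < N) :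
    coeff n (f.subst y * g) = ∑ k ∈ Finset.range N, coeff k f * coeff n (y ^ k * g) := by
  simp only [coeff_mul, Finset.mul_sum]
  rw [Finset.sum_comm]
  refine Finset.sum_congr rfl fun z hz => ?_
  have hz' : z.1 < N := by
    have := Finset.HasAntidiagonal.mem_antidiagonal.1 hz
    omega
  rw [coeff_subst_eq_sum hy f hz', Finset.sum_mul]
  exact Finset.sum_congr rfl fun k _ => by ring

section weights

open LTree

variable (p : ℕ → ℝ≥0∞) (ν : ℤ → ℝ≥0∞)

/-- The weight of a tree, restricted to trees with `n` vertices. -/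
noncomputable def treeWeight (n : ℕ) (T : LTree) : ℝ :=
  if size T = n then (gwlProb p ν T).toReal else 0

/-- The product of the weights of the edges and trees in a forest. -/
noncomputable def forestProd (ts : List (ℤ × LTree)) : ℝ :=
  (ts.map fun x => (ν x.1).toReal * (gwlProb p ν x.2).toReal).prod

/-- The weight of a forest, restricted to forests of `k` trees with `N` vertices in total. -/
noncomputable def forestWeight (k N : ℕ) (ts : List (ℤ × LTree)) : ℝ :=
  if ts.length = k ∧ forestSize ts = N then forestProd p ν ts else 0

theorem toReal_gwlProb_node (ts : List (ℤ × LTree)) :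
    (gwlProb p ν (.node ts)).toReal = (p ts.length).toReal * forestProd p ν ts := by
  rw [gwlProb_node, ENNReal.toReal_mul, forestProd]
  congr 1
  induction ts with
  | nil => simp
  | cons x ts ih =>
    rw [List.map_cons, List.prod_cons, ENNReal.toReal_mul, ih, ENNReal.toReal_mul, List.map_cons,
      List.prod_cons]

theorem treeWeight_zero (T : LTree) : treeWeight p ν 0 T = 0 := by
  have := size_pos T
  simp [treeWeight, this.ne']

theorem forestWeight_cons (k N : ℕ) (x : ℤ × LTree) (ts : List (ℤ × LTree)) :
    forestWeight p ν (k + 1) N (x :: ts) = ∑ z ∈ Finset.HasAntidiagonal.antidiagonal N,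
      ((ν x.1).toReal * treeWeight p ν z.1 x.2) * forestWeight p ν k z.2 ts := by
  by_cases h : size x.2 ≤ N
  · rw [Finset.sum_eq_single (size x.2, N - size x.2)]
    · have h1 : size x.2 + forestSize ts = N ↔ forestSize ts = N - size x.2 := by omega
      simp [forestWeight, treeWeight, forestProd, forestSize_cons, h1]
    · intro z hz hne
      have hz1 : size x.2 ≠ z.1 := fun hz1 => hne (by
        have := Finset.HasAntidiagonal.mem_antidiagonal.1 hz
        ext <;> simp <;> omega)
      simp [treeWeight, hz1]
    · simp [h]
  · rw [Finset.sum_eq_zero]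
    · have : size x.2 + forestSize ts ≠ N := by omega
      simp [forestWeight, forestSize_cons, this]
    · intro z hz
      have := Finset.HasAntidiagonal.mem_antidiagonal.1 hz
      have hz1 : size x.2 ≠ z.1 := by omega
      simp [treeWeight, hz1]

theorem treeWeight_node {n K : ℕ} (hK : n < K) (ts : List (ℤ × LTree)) :
    treeWeight p ν (n + 1) (.node ts) =
      ∑ k ∈ Finset.range K, (p k).toReal * forestWeight p ν k n ts := by
  have h1 : 1 + forestSize ts = n + 1 ↔ forestSize ts = n := by omega
  simp only [treeWeight, size_node, toReal_gwlProb_node, forestWeight, h1]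
  by_cases h : forestSize ts = n
  · rw [Finset.sum_eq_single ts.length]
    · simp [h]
    · intro k _ hk
      simp [hk.symm]
    · intro hk
      have := length_le_forestSize ts
      simp at hk
      omega
  · simp [h]

/-- The characteristic function of the label distribution. -/
noncomputable def labelCharFun (t : ℝ) : ℂ :=
  ∑' k : ℤ, ((ν k).toReal : ℂ) * Complex.exp (Complex.I * k * t)

theorem norm_exp_I_mul_int_mul (k : ℤ) (t : ℝ) : ‖Complex.exp (Complex.I * k * t)‖ = 1 := by
  rw [show Complex.I * k * t = ((k * t : ℝ) : ℂ) * Complex.I by push_cast; ring]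
  exact Complex.norm_exp_ofReal_mul_I _

variable {p ν}

open PowerSeries in
theorem momentBound_forest (hν : HasSum (fun k => (ν k).toReal) 1) (t : ℝ) {y A D : PowerSeries ℝ}
    {n : ℕ} (h : ∀ a < n, MomentBound (treeWeight p ν a) (charSum t)
      (coeff a y) (coeff a A) (coeff a D)) (k : ℕ) :
    ∀ N < n, MomentBound (forestWeight p ν k N) (forestCharSum t) (coeff N (y ^ k))
      (coeff N ((k : PowerSeries ℝ) * y ^ (k - 1) * (C ‖labelCharFun ν t‖ * A)))
      (coeff N ((k : PowerSeries ℝ) * y ^ (k - 1) * D + (k : PowerSeries ℝ) *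
        ((k - 1 : ℕ) : PowerSeries ℝ) * y ^ (k - 2) * (C ‖labelCharFun ν t‖ * A) ^ 2)) := by
  set r := ‖labelCharFun ν t‖ with hr
  induction k with
  | zero =>
    intro N _
    refine MomentBound.of_comp (g := fun _ : Unit => []) (fun _ _ _ => rfl) ?_ ?_
    · intro ts hts
      have : ts.length ≠ 0 := by
        rintro h0
        exact hts ⟨(), (List.length_eq_zero_iff.1 h0).symm⟩
      simp [forestWeight, this]
    · refine ⟨?_, ?_, ?_, ?_, ?_⟩
      · intro _
        simp only [forestWeight]
        split_ifs <;> simp [forestProd]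
      · have h0 : coeff N (y ^ 0) = forestWeight p ν 0 N [] := by
          simp [forestWeight, forestSize, forestProd, coeff_one, eq_comm]
        rw [h0]
        exact hasSum_unique _
      · exact Summable.of_finite
      · simp [forestCharSum]
      · simp [forestCharSum]
  | succ k ih =>
    intro N hN
    refine MomentBound.of_comp (g := fun z : (ℤ × LTree) × List (ℤ × LTree) => z.1 :: z.2)
      ?_ ?_ ?_
    · rintro ⟨x, ts⟩ ⟨x', ts'⟩ hx
      simpa using hx
    · intro ts hts
      rcases ts with _ | ⟨x, ts⟩
      · simp [forestWeight]
      · exact absurd ⟨(x, ts), rfl⟩ hts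
    · simp only [forestWeight_cons, forestCharSum, List.map_cons, List.sum_cons]
      have key : ∀ z ∈ Finset.HasAntidiagonal.antidiagonal N, _ := fun z hz =>
        ((h z.1 (by have := Finset.HasAntidiagonal.mem_antidiagonal.1 hz; omega)).rotate
          (w := fun k => (ν k).toReal) (e := fun k => Complex.exp (Complex.I * k * t))
          (fun _ => ENNReal.toReal_nonneg) hν (fun k => norm_exp_I_mul_int_mul k t)).prod
          (ih z.2 (by have := Finset.HasAntidiagonal.mem_antidiagonal.1 hz; omega))
      have key2 := MomentBound.sum _ key
      change MomentBound _ _ _ (∑ i ∈ Finset.HasAntidiagonal.antidiagonal N, (r * _ * _ + _))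
        (∑ i ∈ Finset.HasAntidiagonal.antidiagonal N, (_ + 2 * (r * _ * _))) at key2
      have hc : ∀ a, r * coeff a A = coeff a (C r * A) := fun a => (coeff_C_mul _ _ _).symm
      convert key2 using 1
      · rfl
      · rw [pow_succ', coeff_mul]
      · simp only [hc]
        rw [Finset.sum_add_distrib, ← coeff_mul, ← coeff_mul, ← map_add]
        congr 1
        rcases k with _ | k
        · simp
        · simp only [Nat.add_sub_cancel]
          push_cast
          ring
      · simp only [hc]
        rw [Finset.sum_add_distrib, Finset.sum_add_distrib, ← Finset.mul_sum, ← coeff_mul,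
          ← coeff_mul, ← coeff_mul, ← coeff_C_mul, ← map_add, ← map_add]
        congr 1
        have h2 : (C (2 : ℝ) : PowerSeries ℝ) = 2 := map_ofNat C 2
        rw [h2]
        rcases k with _ | _ | k
        · simp
        · simp
          ring
        · simp only [Nat.add_sub_cancel, show k + 1 + 1 + 1 - 2 = k + 1 by omega,
            show k + 1 + 1 - 2 = k by omega]
          push_cast
          ring

open PowerSeries in
theorem momentBound_tree_succ (hν : HasSum (fun k => (ν k).toReal) 1) (t : ℝ)
    {y A D : PowerSeries ℝ} (hy : constantCoeff y = 0) {n : ℕ}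
    (h : ∀ a < n + 1, MomentBound (treeWeight p ν a) (charSum t)
      (coeff a y) (coeff a A) (coeff a D)) {Φ : PowerSeries ℝ}
    (hΦ : Φ = PowerSeries.mk fun k => (p k).toReal) :
    MomentBound (treeWeight p ν (n + 1)) (charSum t) (coeff n (Φ.subst y))
      (coeff n (Φ.subst y + (derivative ℝ Φ).subst y * (C ‖labelCharFun ν t‖ * A)))
      (coeff n (Φ.subst y + 2 * ((derivative ℝ Φ).subst y * (C ‖labelCharFun ν t‖ * A)) +
        (derivative ℝ Φ).subst y * D +
        (derivative ℝ (derivative ℝ Φ)).subst y * (C ‖labelCharFun ν t‖ * A) ^ 2)) := by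
  set r := ‖labelCharFun ν t‖ with hr
  refine MomentBound.of_comp (g := LTree.node) (fun _ _ h => by simpa using h) ?_ ?_
  · rintro ⟨ts⟩ hts
    exact absurd ⟨ts, rfl⟩ hts
  simp only [treeWeight_node p ν (show n < n + 3 by omega), charSum_node]
  have key := (MomentBound.sum (Finset.range (n + 3)) fun k _ =>
    (momentBound_forest hν t h k n (Nat.lt_succ_self n)).smul
      (ENNReal.toReal_nonneg (a := p k))).one_add
  have e0 : coeff n (Φ.subst y) =
      ∑ k ∈ Finset.range (n + 3), (p k).toReal * coeff n (y ^ k) := by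
    rw [coeff_subst_eq_sum hy Φ (show n < n + 3 by omega), hΦ]
    simp
  have e1 : ∀ g : PowerSeries ℝ, coeff n ((derivative ℝ Φ).subst y * g) =
      ∑ k ∈ Finset.range (n + 3),
        (p k).toReal * coeff n ((k : PowerSeries ℝ) * y ^ (k - 1) * g) := by
    intro g
    rw [coeff_subst_mul_eq_sum hy _ g (show n < n + 2 by omega), hΦ,
      Finset.sum_range_succ' _ (n + 2)]
    simp only [coeff_derivative, coeff_mk, Nat.add_sub_cancel, Nat.cast_zero, zero_mul, map_zero,
      mul_zero, add_zero]
    refine Finset.sum_congr rfl fun k _ => ?_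
    rw [show ((k + 1 : ℕ) : PowerSeries ℝ) = C ((k : ℝ) + 1) by simp, mul_assoc (C _), coeff_C_mul,
      mul_assoc]
  have e2 : ∀ g : PowerSeries ℝ, coeff n ((derivative ℝ (derivative ℝ Φ)).subst y * g) =
      ∑ k ∈ Finset.range (n + 3), (p k).toReal *
        coeff n ((k : PowerSeries ℝ) * ((k - 1 : ℕ) : PowerSeries ℝ) * y ^ (k - 2) * g) := by
    intro g
    rw [coeff_subst_mul_eq_sum hy _ g (show n < n + 1 by omega), hΦ,
      Finset.sum_range_succ' _ (n + 2), Finset.sum_range_succ' _ (n + 1)]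
    simp only [coeff_derivative, coeff_mk, Nat.add_sub_cancel, Nat.cast_zero, zero_mul, map_zero,
      mul_zero, add_zero, zero_add, Nat.sub_self]
    refine Finset.sum_congr rfl fun k _ => ?_
    rw [show ((k + 1 + 1 : ℕ) : PowerSeries ℝ) * ((k + 1 : ℕ) : PowerSeries ℝ) =
      C (((k : ℝ) + 1 + 1) * ((k : ℝ) + 1)) by simp, mul_assoc (C _), coeff_C_mul,
      show k + 1 + 1 - 2 = k by omega]
    push_cast
    ring
  convert key using 1
  · rw [map_add, e0, e1]
  · have h2 : (2 : PowerSeries ℝ) = C (2 : ℝ) := (map_ofNat C 2).symm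
    simp only [map_add, h2, coeff_C_mul, e0, e1, e2, mul_add, Finset.sum_add_distrib]
    ring

end weights

namespace PowerSeries

theorem coeff_mul_nonneg {f g : PowerSeries ℝ} (hf : ∀ n, 0 ≤ coeff n f)
    (hg : ∀ n, 0 ≤ coeff n g) (n : ℕ) : 0 ≤ coeff n (f * g) := by
  rw [coeff_mul]
  exact Finset.sum_nonneg fun z _ => mul_nonneg (hf _) (hg _)

theorem coeff_pow_nonneg {f : PowerSeries ℝ} (hf : ∀ n, 0 ≤ coeff n f) (k n : ℕ) :
    0 ≤ coeff n (f ^ k) := by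
  induction k generalizing n with
  | zero => rw [pow_zero, coeff_one]; split_ifs <;> simp
  | succ k ih => rw [pow_succ]; exact coeff_mul_nonneg ih hf n

theorem coeff_X_nonneg (n : ℕ) : 0 ≤ coeff n (X : PowerSeries ℝ) := by
  rw [coeff_X]; split_ifs <;> simp

theorem coeff_mul_le_coeff_mul {f f' g g' : PowerSeries ℝ} (hf : ∀ n, 0 ≤ coeff n f)
    (hg' : ∀ n, 0 ≤ coeff n g') (hff' : ∀ n, coeff n f ≤ coeff n f')
    (hgg' : ∀ n, coeff n g ≤ coeff n g') (n : ℕ) : coeff n (f * g) ≤ coeff n (f' * g') := by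
  rw [coeff_mul, coeff_mul]
  exact Finset.sum_le_sum fun z _ =>
    (mul_le_mul_of_nonneg_left (hgg' _) (hf _)).trans (mul_le_mul_of_nonneg_right (hff' _) (hg' _))

theorem coeff_subst_nonneg {f y : PowerSeries ℝ} (hy0 : constantCoeff y = 0)
    (hf : ∀ n, 0 ≤ coeff n f) (hy : ∀ n, 0 ≤ coeff n y) (n : ℕ) : 0 ≤ coeff n (f.subst y) := by
  rw [coeff_subst_eq_sum hy0 f (Nat.lt_succ_self n)]
  exact Finset.sum_nonneg fun k _ => mul_nonneg (hf k) (coeff_pow_nonneg hy k n)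

theorem coeff_derivative_nonneg {f : PowerSeries ℝ} (hf : ∀ n, 0 ≤ coeff n f) (n : ℕ) :
    0 ≤ coeff n (derivative ℝ f) := by
  rw [coeff_derivative]
  exact mul_nonneg (hf _) (by positivity)

theorem coeff_nonneg_of_sub_mul {G E : PowerSeries ℝ} (hG0 : constantCoeff G = 0)
    (hG : ∀ n, 0 ≤ coeff n G) (h : ∀ n, 0 ≤ coeff n (E - G * E)) (n : ℕ) : 0 ≤ coeff n E := by
  induction n using Nat.strong_induction_on with
  | _ n ih =>
    have h1 := h n
    rw [map_sub, sub_nonneg] at h1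
    refine le_trans ?_ h1
    rw [coeff_mul]
    refine Finset.sum_nonneg fun z hz => ?_
    have hz' := Finset.HasAntidiagonal.mem_antidiagonal.1 hz
    rcases Nat.eq_zero_or_pos z.1 with h0 | h0
    · rw [h0, coeff_zero_eq_constantCoeff, hG0, zero_mul]
    · exact mul_nonneg (hG _) (ih _ (by omega))

theorem sum_coeff_mul_le {f g : PowerSeries ℝ} {a b : ℝ} (hf : ∀ n, 0 ≤ coeff n f)
    (hg : ∀ n, 0 ≤ coeff n g) (hfa : ∀ N, ∑ k ∈ Finset.range N, coeff k f ≤ a)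
    (hgb : ∀ N, ∑ k ∈ Finset.range N, coeff k g ≤ b) (N : ℕ) :
    ∑ k ∈ Finset.range N, coeff k (f * g) ≤ a * b := by
  have ha : 0 ≤ a := by simpa using hfa 0
  calc ∑ k ∈ Finset.range N, coeff k (f * g)
      = ∑ k ∈ Finset.range N, ∑ z ∈ Finset.HasAntidiagonal.antidiagonal k,
          coeff z.1 f * coeff z.2 g := by simp only [coeff_mul]
    _ = ∑ w ∈ (Finset.range N).sigma fun k => Finset.HasAntidiagonal.antidiagonal k,
          coeff w.2.1 f * coeff w.2.2 g := by rw [Finset.sum_sigma]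
    _ = ∑ z ∈ ((Finset.range N).sigma fun k => Finset.HasAntidiagonal.antidiagonal k).image
          (fun w : (_ : ℕ) × ℕ × ℕ => w.2), coeff z.1 f * coeff z.2 g := by
        rw [Finset.sum_image]
        rintro ⟨k, z⟩ hz ⟨k', z'⟩ hz' h
        simp at hz hz' h
        obtain rfl : z = z' := h
        obtain rfl : k = k' := by omega
        rfl
    _ ≤ ∑ z ∈ Finset.range N ×ˢ Finset.range N, coeff z.1 f * coeff z.2 g := by
        refine Finset.sum_le_sum_of_subset_of_nonneg ?_ fun z _ _ => mul_nonneg (hf _) (hg _)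
        intro z hz
        simp at hz
        simp
        omega
    _ = (∑ k ∈ Finset.range N, coeff k f) * ∑ k ∈ Finset.range N, coeff k g := by
        rw [Finset.sum_mul_sum, Finset.sum_product]
    _ ≤ a * b := mul_le_mul (hfa N) (hgb N) (Finset.sum_nonneg fun k _ => hg k) ha

theorem sum_coeff_pow_le_one {f : PowerSeries ℝ} (hf : ∀ n, 0 ≤ coeff n f)
    (hf1 : ∀ N, ∑ k ∈ Finset.range N, coeff k f ≤ 1) (k N : ℕ) :
    ∑ j ∈ Finset.range N, coeff j (f ^ k) ≤ 1 := by
  induction k generalizing N with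
  | zero =>
    simp only [pow_zero, coeff_one, Finset.sum_ite_eq']
    split_ifs <;> simp
  | succ k ih =>
    rw [pow_succ]
    simpa using sum_coeff_mul_le (coeff_pow_nonneg hf k) hf ih hf1 N

theorem sum_coeff_X_pow_le_one (k N : ℕ) :
    ∑ j ∈ Finset.range N, coeff j ((X : PowerSeries ℝ) ^ k) ≤ 1 := by
  simp only [coeff_X_pow, Finset.sum_ite_eq']
  split_ifs <;> simp

/-- The series `∑ G ^ k r ^ k`. -/
noncomputable def geom (r : ℝ) (G : PowerSeries ℝ) : PowerSeries ℝ := (mk fun k => r ^ k).subst G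

theorem mk_pow_mul (r : ℝ) : (mk fun k => r ^ k) * (1 - C r * X) = (1 : PowerSeries ℝ) := by
  ext n
  rw [mul_sub, mul_one, map_sub, ← mul_assoc, mul_comm _ (C r), mul_assoc, coeff_C_mul]
  cases n with
  | zero => simp
  | succ n => simp [coeff_succ_mul_X, coeff_one, pow_succ']

theorem geom_mul {r : ℝ} {G : PowerSeries ℝ} (hG : constantCoeff G = 0) :
    geom r G * (1 - C r * G) = 1 := by
  have hs := HasSubst.of_constantCoeff_zero' hG
  have h := congrArg (fun f : PowerSeries ℝ => f.subst G) (mk_pow_mul r)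
  have h1 : (C r : PowerSeries ℝ).subst G = C r := by
    rw [subst_C]; rfl
  have h2 : (1 : PowerSeries ℝ).subst G = 1 := by
    rw [← coe_substAlgHom hs, map_one]
  simp only [subst_mul hs, subst_sub hs, h1, h2, subst_X hs] at h
  exact h

theorem mk_pow_sq (r : ℝ) :
    (mk fun k => r ^ k) ^ 2 = (mk fun k => ((k : ℝ) + 1) * r ^ k : PowerSeries ℝ) := by
  ext n
  rw [sq, coeff_mul, coeff_mk, Finset.sum_congr rfl (g := fun _ => r ^ n)]
  · simp
  · intro z hz
    rw [coeff_mk, coeff_mk, ← pow_add, Finset.HasAntidiagonal.mem_antidiagonal.1 hz]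

theorem coeff_geom_nonneg {r : ℝ} (hr : 0 ≤ r) {G : PowerSeries ℝ} (hG0 : constantCoeff G = 0)
    (hG : ∀ n, 0 ≤ coeff n G) (n : ℕ) : 0 ≤ coeff n (geom r G) :=
  coeff_subst_nonneg hG0 (fun k => by rw [coeff_mk]; positivity) hG n

theorem geom_sq {r : ℝ} {G : PowerSeries ℝ} (hG : constantCoeff G = 0) :
    geom r G ^ 2 = (mk fun k => ((k : ℝ) + 1) * r ^ k : PowerSeries ℝ).subst G := by
  rw [geom, ← subst_pow (HasSubst.of_constantCoeff_zero' hG), mk_pow_sq]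

theorem coeff_geom_le_sq {r : ℝ} (hr : 0 ≤ r) {G : PowerSeries ℝ} (hG0 : constantCoeff G = 0)
    (hG : ∀ n, 0 ≤ coeff n G) (n : ℕ) : coeff n (geom r G) ≤ coeff n (geom r G ^ 2) := by
  rw [geom_sq hG0, geom, ← sub_nonneg, ← map_sub,
    ← subst_sub (HasSubst.of_constantCoeff_zero' hG0)]
  refine coeff_subst_nonneg hG0 (fun k => ?_) hG n
  rw [map_sub, coeff_mk, coeff_mk]
  nlinarith [mul_nonneg (Nat.cast_nonneg (α := ℝ) k) (pow_nonneg hr k)]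

section functionalEquation

variable {y Φ : PowerSeries ℝ}

theorem natCast_mul_coeff_pow (hy0 : constantCoeff y = 0) (hy : y = X * Φ.subst y) (n : ℕ) :
    ∀ l m, l + m = n → (n : ℝ) * coeff n (y ^ l) = l * coeff m (Φ ^ n) := by
  induction n with
  | zero =>
    intro l m h
    obtain rfl : l = 0 := by omega
    simp
  | succ n ih =>
    intro l m h
    rcases l with _ | l
    · simp [coeff_one]
    have e1 : coeff (n + 1) (y ^ (l + 1)) =
        ∑ z ∈ Finset.HasAntidiagonal.antidiagonal m, coeff z.1 Φ * coeff n (y ^ (l + z.1)) := by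
      have h1 : y ^ (l + 1) = X * (Φ.subst y * y ^ l) := by
        conv_lhs => rw [pow_succ, hy]
        conv_rhs => rw [← mul_assoc, ← hy]
        rw [← hy, mul_comm]
      rw [h1, coeff_succ_X_mul, coeff_subst_mul_eq_sum hy0 _ _ (Nat.lt_succ_self n),
        Finset.Nat.sum_antidiagonal_eq_sum_range_succ_mk]
      symm
      refine Finset.sum_subset_zero_on_sdiff (Finset.range_mono (by omega)) ?_ ?_
      · intro k hk
        simp at hk
        rw [← pow_add, coeff_pow_eq_zero_of_lt hy0 (by omega), mul_zero]
      · intro k _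
        rw [← pow_add, add_comm l]
    rcases Nat.eq_zero_or_pos n with rfl | hn
    · obtain rfl : l = 0 := by omega
      obtain rfl : m = 0 := by omega
      rw [e1]
      simp
    have e2 : (n : ℝ) * coeff (n + 1) (y ^ (l + 1)) =
        l * coeff m (Φ ^ (n + 1)) + coeff m (X * derivative ℝ Φ * Φ ^ n) := by
      rw [e1, Finset.mul_sum, pow_succ', coeff_mul, coeff_mul, Finset.mul_sum,
        ← Finset.sum_add_distrib]
      refine Finset.sum_congr rfl fun z hz => ?_
      have hz' := Finset.HasAntidiagonal.mem_antidiagonal.1 hz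
      have h2 := ih (l + z.1) z.2 (by omega)
      have h3 : coeff z.1 (X * derivative ℝ Φ) = z.1 * coeff z.1 Φ := by
        rcases z.1 with _ | k
        · simp
        · rw [coeff_succ_X_mul, coeff_derivative]; push_cast; ring
      rw [h3]
      push_cast at h2
      linear_combination coeff z.1 Φ * h2
    have e3 : ((n : ℝ) + 1) * coeff m (X * derivative ℝ Φ * Φ ^ n) =
        m * coeff m (Φ ^ (n + 1)) := by
      have h4 : X * derivative ℝ (Φ ^ (n + 1)) =
          C ((n : ℝ) + 1) * (X * derivative ℝ Φ * Φ ^ n) := by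
        rw [derivative_pow]
        simp
        ring
      rw [← coeff_C_mul, ← h4]
      rcases m with _ | k
      · simp
      · rw [coeff_succ_X_mul, coeff_derivative]; push_cast; ring
    have hnm : (n : ℝ) = l + m := by
      have : n = l + m := by omega
      exact_mod_cast this
    have hn' : (n : ℝ) ≠ 0 := by positivity
    apply mul_left_cancel₀ hn'
    push_cast
    linear_combination ((n : ℝ) + 1) * e2 + e3 - (coeff m (Φ ^ (n + 1))) * hnm

theorem X_mul_derivative_eq (hy0 : constantCoeff y = 0) (hy : y = X * Φ.subst y) :
    X * derivative ℝ y = y * geom 1 (X * (derivative ℝ Φ).subst y) := by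
  set G := X * (derivative ℝ Φ).subst y with hG
  have hG0 : constantCoeff G = 0 := by simp [hG]
  have h1 : derivative ℝ y = Φ.subst y + G * derivative ℝ y := by
    conv_lhs => rw [hy]
    rw [Derivation.leibniz, derivative_subst (HasSubst.of_constantCoeff_zero' hy0)]
    simp [hG, smul_eq_mul]
    ring
  have h2 : X * derivative ℝ y * (1 - C 1 * G) = y := by
    rw [map_one, one_mul]
    linear_combination X * h1 - hy
  have h3 := geom_mul (r := 1) hG0
  linear_combination (-(X * derivative ℝ y)) * h3 + geom 1 G * h2

theorem coeff_pow_mul_geom_le (hy0 : constantCoeff y = 0) (hy : y = X * Φ.subst y) {n l : ℕ}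
    (hl : 1 ≤ l) {b : ℝ} (hb0 : 0 ≤ b) (hb : ∀ j, coeff j (Φ ^ n) ≤ b) :
    coeff n (y ^ l * geom 1 (X * (derivative ℝ Φ).subst y)) ≤ b := by
  set S := geom 1 (X * (derivative ℝ Φ).subst y) with hS
  have h1 : (n : ℝ) * coeff n (y ^ l) = l * coeff n (y ^ l * S) := by
    have h2 : X * derivative ℝ (y ^ l) = C (l : ℝ) * (y ^ l * S) := by
      obtain ⟨l, rfl⟩ : ∃ k, l = k + 1 := ⟨l - 1, by omega⟩
      rw [derivative_pow]
      have := X_mul_derivative_eq hy0 hy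
      rw [← hS] at this
      simp
      linear_combination ((l : PowerSeries ℝ) + 1) * y ^ l * this
    have h3 : (l : ℝ) * coeff n (y ^ l * S) = coeff n (C (l : ℝ) * (y ^ l * S)) :=
      (coeff_C_mul _ _ _).symm
    rw [h3, ← h2]
    rcases n with _ | n
    · simp
    · rw [coeff_succ_X_mul, coeff_derivative]; push_cast; ring
  have hl' : (0 : ℝ) < l := by exact_mod_cast hl
  rcases le_or_gt l n with hln | hln
  · rw [natCast_mul_coeff_pow hy0 hy n l (n - l) (by omega)] at h1
    rw [← mul_left_cancel₀ hl'.ne' h1]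
    exact hb _
  · rw [coeff_pow_eq_zero_of_lt hy0 hln, mul_zero] at h1
    rw [(mul_eq_zero.1 h1.symm).resolve_left hl'.ne']
    exact hb0

theorem coeff_subst_mul_geom_le (hy0 : constantCoeff y = 0) (hy : y = X * Φ.subst y)
    {H : PowerSeries ℝ} (hH0 : constantCoeff H = 0) (hH : ∀ n, 0 ≤ coeff n H) {c : ℝ}
    (hHc : ∀ N, ∑ k ∈ Finset.range N, coeff k H ≤ c) {n : ℕ} {b : ℝ} (hb0 : 0 ≤ b)
    (hb : 1 ≤ n → ∀ j, coeff j (Φ ^ n) ≤ b) :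
    coeff n (H.subst y * geom 1 (X * (derivative ℝ Φ).subst y)) ≤ c * b := by
  have hc : 0 ≤ c := by simpa using hHc 0
  rw [coeff_subst_mul_eq_sum hy0 _ _ (Nat.lt_succ_self n)]
  rcases Nat.eq_zero_or_pos n with rfl | hn
  · simpa [hH0] using mul_nonneg hc hb0
  refine le_trans ?_ (mul_le_mul_of_nonneg_right (hHc (n + 1)) hb0)
  rw [Finset.sum_mul]
  refine Finset.sum_le_sum fun k _ => ?_
  rcases Nat.eq_zero_or_pos k with rfl | hk
  · simp [hH0]
  · exact mul_le_mul_of_nonneg_left (coeff_pow_mul_geom_le hy0 hy hk hb0 (hb hn)) (hH k)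

end functionalEquation

theorem coeff_le_of_quadratic_recursion {y Φ A D : PowerSeries ℝ} {r c : ℝ} {B : ℕ → ℝ}
    (hy0 : constantCoeff y = 0) (hy : y = X * Φ.subst y) (hyn : ∀ n, 0 ≤ coeff n y)
    (hΦ : ∀ n, 0 ≤ coeff n Φ)
    (hΦ1 : ∀ N, ∑ k ∈ Finset.range N, coeff k (derivative ℝ Φ) ≤ 1)
    (hΦ2 : ∀ N, ∑ k ∈ Finset.range N, coeff k (derivative ℝ (derivative ℝ Φ)) ≤ c)
    (hr0 : 0 ≤ r) (hr1 : r ≤ 1) (hB0 : ∀ n, 0 ≤ B n)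
    (hB : ∀ n, 1 ≤ n → ∀ j, coeff j (Φ ^ n) ≤ B n) (hA0 : ∀ n, 0 ≤ coeff n A)
    (hA : ∀ n, coeff n A ≤ coeff n (y + X * (derivative ℝ Φ).subst y * (C r * A)))
    (hD : ∀ n, coeff n D ≤ coeff n (y + 2 * (X * (derivative ℝ Φ).subst y * (C r * A)) +
      X * (derivative ℝ Φ).subst y * D +
      X * (derivative ℝ (derivative ℝ Φ)).subst y * (C r * A) ^ 2)) (n : ℕ) :
    coeff n D ≤ ∑ k ∈ Finset.range (n + 1),
      ((k : ℝ) + 1) * r ^ k * (2 * B (n - k) + c * B (n - (k + 1))) := by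
  set Φ₁ := derivative ℝ Φ with hΦ₁
  set Φ₂ := derivative ℝ Φ₁ with hΦ₂
  set G := X * Φ₁.subst y with hG
  set P := X * Φ₂.subst y with hP
  have hs := HasSubst.of_constantCoeff_zero' hy0
  have hΦ₁0 : ∀ n, 0 ≤ coeff n Φ₁ := coeff_derivative_nonneg hΦ
  have hΦ₂0 : ∀ n, 0 ≤ coeff n Φ₂ := coeff_derivative_nonneg hΦ₁0
  have hGc : constantCoeff G = 0 := by simp [hG]
  have hGn : ∀ n, 0 ≤ coeff n G :=
    coeff_mul_nonneg coeff_X_nonneg (coeff_subst_nonneg hy0 hΦ₁0 hyn)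
  have hPn : ∀ n, 0 ≤ coeff n P :=
    coeff_mul_nonneg coeff_X_nonneg (coeff_subst_nonneg hy0 hΦ₂0 hyn)
  have hCn : ∀ {s : ℝ}, 0 ≤ s → ∀ n, 0 ≤ coeff n (C s : PowerSeries ℝ) := by
    intro s hs n
    rw [coeff_C]; split_ifs <;> simp [hs]
  set R := geom r G with hR
  set S := geom 1 G with hS
  have hRn : ∀ n, 0 ≤ coeff n R := coeff_geom_nonneg hr0 hGc hGn
  have hSn : ∀ n, 0 ≤ coeff n S := coeff_geom_nonneg zero_le_one hGc hGn
  have hRm : R * (1 - C r * G) = 1 := geom_mul hGc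
  have hSm : S * (1 - G) = 1 := by simpa using geom_mul (r := 1) hGc
  set A' := y * R with hA'
  have hA'n : ∀ n, 0 ≤ coeff n A' := coeff_mul_nonneg hyn hRn
  have hAA' : ∀ n, coeff n A ≤ coeff n A' := by
    intro n
    rw [← sub_nonneg, ← map_sub]
    refine coeff_nonneg_of_sub_mul (G := C r * G) (by simp [hGc])
      (coeff_mul_nonneg (hCn hr0) hGn) (fun m => ?_) n
    rw [show A' - A - C r * G * (A' - A) = y + G * (C r * A) - A by
      linear_combination y * hRm, map_sub, sub_nonneg]
    exact hA m
  have hrA : ∀ n, coeff n (C r * A) ≤ coeff n (C r * A') := by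
    intro n
    rw [coeff_C_mul, coeff_C_mul]
    exact mul_le_mul_of_nonneg_left (hAA' n) hr0
  have hrA0 : ∀ n, 0 ≤ coeff n (C r * A) := coeff_mul_nonneg (hCn hr0) hA0
  have hrA'0 : ∀ n, 0 ≤ coeff n (C r * A') := coeff_mul_nonneg (hCn hr0) hA'n
  have h2 : (2 : PowerSeries ℝ) = C (2 : ℝ) := (map_ofNat C 2).symm
  set D' := S * (y + 2 * (G * (C r * A')) + P * (C r * A') ^ 2) with hD'
  have hDD' : coeff n D ≤ coeff n D' := by
    rw [← sub_nonneg, ← map_sub]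
    refine coeff_nonneg_of_sub_mul hGc hGn (fun m => ?_) n
    have e : D' - D - G * (D' - D) =
        (y + 2 * (G * (C r * A)) + G * D + P * (C r * A) ^ 2 - D) +
        (C 2 * (G * (C r * A') - G * (C r * A)) +
          (P * ((C r * A') * (C r * A')) - P * ((C r * A) * (C r * A)))) := by
      rw [← h2]
      linear_combination (y + 2 * (G * (C r * A')) + P * (C r * A') ^ 2) * hSm
    rw [e, map_add]
    refine add_nonneg (by rw [map_sub]; exact sub_nonneg.2 (hD m)) ?_
    rw [map_add, coeff_C_mul, map_sub, map_sub]
    refine add_nonneg (mul_nonneg zero_le_two ?_) ?_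
    · exact sub_nonneg.2 (coeff_mul_le_coeff_mul hGn hrA'0 (fun _ => le_rfl) hrA m)
    · refine sub_nonneg.2 (coeff_mul_le_coeff_mul hPn (coeff_mul_nonneg hrA'0 hrA'0)
        (fun _ => le_rfl) (fun j => ?_) m)
      exact coeff_mul_le_coeff_mul hrA0 hrA'0 hrA hrA j
  set K := S * (2 * y + P * y ^ 2) with hK
  have hDK : coeff n D' ≤ coeff n (R ^ 2 * K) := by
    rw [← sub_nonneg, ← map_sub]
    have e : R ^ 2 * K - D' = S * (C 2 * (y * (R ^ 2 - R)) + y +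
        C (1 - r ^ 2) * (P * (y ^ 2 * R ^ 2))) := by
      rw [← h2, map_sub, map_one, map_pow]
      linear_combination (2 * S * y) * hRm
    rw [e]
    refine coeff_mul_nonneg hSn (fun m => ?_) n
    rw [map_add, map_add]
    refine add_nonneg (add_nonneg ?_ (hyn m)) ?_
    · refine coeff_mul_nonneg (hCn zero_le_two) (coeff_mul_nonneg hyn fun j => ?_) m
      rw [map_sub, sub_nonneg]
      exact coeff_geom_le_sq hr0 hGc hGn j
    · exact coeff_mul_nonneg (hCn (by nlinarith)) (coeff_mul_nonneg hPn
        (coeff_mul_nonneg (coeff_pow_nonneg hyn 2) (coeff_pow_nonneg hRn 2))) m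
  refine hDD'.trans (hDK.trans ?_)
  rw [hR, geom_sq hGc, coeff_subst_mul_eq_sum hGc _ _ (Nat.lt_succ_self n)]
  refine Finset.sum_le_sum fun k _ => ?_
  rw [coeff_mk]
  refine mul_le_mul_of_nonneg_left ?_ (by positivity)
  have hΦ₁k := sum_coeff_pow_le_one hΦ₁0 hΦ1 k
  have hΦ₁kn := coeff_pow_nonneg hΦ₁0 k
  have e : G ^ k * K = C 2 * (X ^ k * ((Φ₁ ^ k * X).subst y * S)) +
      X ^ (k + 1) * ((Φ₁ ^ k * Φ₂ * X ^ 2).subst y * S) := by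
    rw [← h2, subst_mul hs, subst_mul hs, subst_mul hs, subst_pow hs, subst_pow hs, subst_X hs]
    rw [hK, hG, hP]
    ring
  rw [e, map_add, coeff_C_mul, coeff_X_pow_mul', coeff_X_pow_mul']
  have hc : 0 ≤ c := by simpa using hΦ2 0
  refine add_le_add (mul_le_mul_of_nonneg_left ?_ zero_le_two) ?_
  · split_ifs
    · have h3 := sum_coeff_mul_le hΦ₁kn coeff_X_nonneg hΦ₁k
        (by simpa using sum_coeff_X_pow_le_one 1)
      simpa using coeff_subst_mul_geom_le hy0 hy (by simp) (coeff_mul_nonneg hΦ₁kn coeff_X_nonneg)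
        h3 (hB0 (n - k)) (hB (n - k))
    · exact hB0 _
  · split_ifs
    · have h4 := sum_coeff_mul_le hΦ₁kn hΦ₂0 hΦ₁k hΦ2
      have h5 := sum_coeff_mul_le (coeff_mul_nonneg hΦ₁kn hΦ₂0) (coeff_pow_nonneg coeff_X_nonneg 2)
        h4 (sum_coeff_X_pow_le_one 2)
      simpa using coeff_subst_mul_geom_le hy0 hy (by simp) (coeff_mul_nonneg
        (coeff_mul_nonneg hΦ₁kn hΦ₂0) (coeff_pow_nonneg coeff_X_nonneg 2))
        h5 (hB0 (n - (k + 1))) (hB (n - (k + 1)))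
    · exact mul_nonneg hc (hB0 _)

end PowerSeries

section treeSeries

open PowerSeries LTree

variable (p : ℕ → ℝ≥0∞) (ν : ℤ → ℝ≥0∞)

/-- The generating function of the offspring distribution. -/
noncomputable def offspringSeries : PowerSeries ℝ := mk fun k => (p k).toReal

/-- The generating function of the total size of the tree. -/
noncomputable def sizeSeries : PowerSeries ℝ := mk fun n => ∑' T, treeWeight p ν n T

/-- The generating function of the moduli of the unnormalised first moments of `charSum t`. -/
noncomputable def firstSeries (t : ℝ) : PowerSeries ℝ :=
  mk fun n => ‖∑' T, (treeWeight p ν n T : ℂ) * charSum t T‖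

/-- The generating function of the unnormalised second moments of `charSum t`. -/
noncomputable def secondSeries (t : ℝ) : PowerSeries ℝ :=
  mk fun n => ∑' T, treeWeight p ν n T * ‖charSum t T‖ ^ 2

variable {p ν}

theorem coeff_offspringSeries_nonneg (n : ℕ) : 0 ≤ coeff n (offspringSeries p) := by
  rw [offspringSeries, coeff_mk]; exact ENNReal.toReal_nonneg

theorem constantCoeff_sizeSeries : constantCoeff (sizeSeries p ν) = 0 := by
  rw [← coeff_zero_eq_constantCoeff_apply, sizeSeries, coeff_mk]
  simp [treeWeight_zero]

theorem momentBound_tree (hν : HasSum (fun k => (ν k).toReal) 1) (t : ℝ) (n : ℕ) :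
    MomentBound (treeWeight p ν n) (charSum t) (coeff n (sizeSeries p ν))
      (coeff n (firstSeries p ν t)) (coeff n (secondSeries p ν t)) := by
  induction n using Nat.strong_induction_on with
  | _ n ih =>
    rcases n with _ | n
    · simp only [sizeSeries, firstSeries, secondSeries, coeff_mk, treeWeight_zero]
      have h0 : treeWeight p ν 0 = fun _ => 0 := funext fun T => treeWeight_zero p ν T
      rw [h0]
      simpa using MomentBound.zero (X := charSum t)
    · have K := momentBound_tree_succ hν t constantCoeff_sizeSeries ih rfl
      simp only [sizeSeries, firstSeries, secondSeries, coeff_mk]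
      exact ⟨K.nonneg, K.hasSum.summable.hasSum, K.summable_sq, le_rfl, le_rfl⟩

theorem sizeSeries_eq (hν : HasSum (fun k => (ν k).toReal) 1) :
    sizeSeries p ν = X * (offspringSeries p).subst (sizeSeries p ν) := by
  ext n
  rcases n with _ | n
  · simp [constantCoeff_sizeSeries]
  · have K := momentBound_tree_succ hν 0 constantCoeff_sizeSeries
      (fun a (_ : a < n + 1) => momentBound_tree (p := p) hν 0 a) rfl
    rw [coeff_succ_X_mul]
    exact (momentBound_tree hν 0 (n + 1)).hasSum.unique K.hasSum

theorem coeff_firstSeries_le (hν : HasSum (fun k => (ν k).toReal) 1) (t : ℝ) (n : ℕ) :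
    coeff n (firstSeries p ν t) ≤ coeff n (sizeSeries p ν +
      X * (derivative ℝ (offspringSeries p)).subst (sizeSeries p ν) *
        (C ‖labelCharFun ν t‖ * firstSeries p ν t)) := by
  have e : ∀ a b : PowerSeries ℝ, sizeSeries p ν + X * a * b =
      X * ((offspringSeries p).subst (sizeSeries p ν) + a * b) := by
    intro a b
    linear_combination sizeSeries_eq (p := p) hν
  rw [e]
  rcases n with _ | n
  · simp [firstSeries, treeWeight_zero]
  · have K := momentBound_tree_succ hν t constantCoeff_sizeSeries
      (fun a (_ : a < n + 1) => momentBound_tree (p := p) hν t a) rfl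
    rw [coeff_succ_X_mul, firstSeries, coeff_mk]
    exact K.norm_le

theorem coeff_secondSeries_le (hν : HasSum (fun k => (ν k).toReal) 1) (t : ℝ) (n : ℕ) :
    coeff n (secondSeries p ν t) ≤ coeff n (sizeSeries p ν +
      2 * (X * (derivative ℝ (offspringSeries p)).subst (sizeSeries p ν) *
        (C ‖labelCharFun ν t‖ * firstSeries p ν t)) +
      X * (derivative ℝ (offspringSeries p)).subst (sizeSeries p ν) * secondSeries p ν t +
      X * (derivative ℝ (derivative ℝ (offspringSeries p))).subst (sizeSeries p ν) *
        (C ‖labelCharFun ν t‖ * firstSeries p ν t) ^ 2) := by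
  have e : ∀ a b c d : PowerSeries ℝ, sizeSeries p ν + 2 * (X * a * b) + X * a * c + X * d * b ^ 2 =
      X * ((offspringSeries p).subst (sizeSeries p ν) + 2 * (a * b) + a * c + d * b ^ 2) := by
    intro a b c d
    linear_combination sizeSeries_eq (p := p) hν
  rw [e]
  rcases n with _ | n
  · simp [secondSeries, treeWeight_zero]
  · have K := momentBound_tree_succ hν t constantCoeff_sizeSeries
      (fun a (_ : a < n + 1) => momentBound_tree (p := p) hν t a) rfl
    rw [coeff_succ_X_mul, secondSeries, coeff_mk]
    exact K.sq_le

end treeSeries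

theorem sq_mul_sum_succ_mul_pow_le_one {r : ℝ} (hr0 : 0 ≤ r) (hr1 : r ≤ 1) (N : ℕ) :
    (1 - r) ^ 2 * ∑ k ∈ Finset.range N, ((k : ℝ) + 1) * r ^ k ≤ 1 := by
  have h : (1 - r) ^ 2 * ∑ k ∈ Finset.range N, ((k : ℝ) + 1) * r ^ k =
      1 - (N + 1) * r ^ N + N * r ^ (N + 1) := by
    induction N with
    | zero => simp
    | succ N ih =>
      rw [Finset.sum_range_succ, mul_add, ih]
      push_cast
      ring
  rw [h, pow_succ]
  have h1 : (N : ℝ) * (r ^ N * r) ≤ N * (r ^ N * 1) := by gcongr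
  nlinarith [pow_nonneg hr0 N]

theorem sq_mul_sq_mul_pow_le_two {r : ℝ} (hr0 : 0 ≤ r) (hr1 : r ≤ 1) (k : ℕ) :
    (1 - r) ^ 2 * (((k : ℝ) + 1) ^ 2 * r ^ k) ≤ 2 := by
  have h1 := sq_mul_sum_succ_mul_pow_le_one hr0 hr1 (k + 1)
  have h2 : ∑ j ∈ Finset.range (k + 1), ((j : ℝ) + 1) * r ^ k ≤
      ∑ j ∈ Finset.range (k + 1), ((j : ℝ) + 1) * r ^ j := by
    refine Finset.sum_le_sum fun j hj => ?_
    have : r ^ k ≤ r ^ j := pow_le_pow_of_le_one hr0 hr1 (by simp at hj; omega)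
    gcongr
  have h3 : ∀ N : ℕ, ∑ j ∈ Finset.range N, ((j : ℝ) + 1) = N * (N + 1) / 2 := by
    intro N
    induction N with
    | zero => simp
    | succ N ih => rw [Finset.sum_range_succ, ih]; push_cast; ring
  rw [← Finset.sum_mul, h3] at h2
  push_cast at h2
  have h4 : ((k : ℝ) + 1) ^ 2 * r ^ k ≤
      2 * ∑ j ∈ Finset.range (k + 1), ((j : ℝ) + 1) * r ^ j := by
    nlinarith [mul_nonneg (Nat.cast_nonneg (α := ℝ) k) (pow_nonneg hr0 k), pow_nonneg hr0 k]
  nlinarith [sq_nonneg (1 - r)]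

theorem sum_inv_sqrt_le (n : ℕ) :
    ∑ k ∈ Finset.range (n + 1), (√((k : ℕ) : ℝ))⁻¹ ≤ 2 * √(n : ℝ) := by
  induction n with
  | zero => simp
  | succ n ih =>
    rw [Finset.sum_range_succ]
    refine (add_le_add_left ih _).trans ?_
    set a := √(n : ℝ) with ha
    set b := √((n + 1 : ℕ) : ℝ) with hb
    have ha2 : a ^ 2 = n := Real.sq_sqrt (by positivity)
    have hb2 : b ^ 2 = n + 1 := by rw [hb, Real.sq_sqrt (by positivity)]; push_cast; ring
    have hb0 : 0 < b := Real.sqrt_pos.2 (by positivity)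
    have ha0 : 0 ≤ a := Real.sqrt_nonneg _
    rw [← sub_nonneg]
    have : 2 * b - (2 * a + b⁻¹) = (b - a) ^ 2 / b := by
      field_simp
      nlinarith
    rw [this]
    positivity

theorem sum_succ_mul_pow_div_sqrt_le {r : ℝ} (hr0 : 0 ≤ r) (hr1 : r < 1) {n : ℕ} (hn : 1 ≤ n) :
    ∑ k ∈ Finset.range (n + 1), ((k : ℝ) + 1) * r ^ k * (√((n - k : ℕ) : ℝ))⁻¹ ≤
      10 / ((1 - r) ^ 2 * √(n : ℝ)) := by
  have hδ : 0 < (1 - r) ^ 2 := by have : 0 < 1 - r := by linarith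
                                  positivity
  have hn0 : (0 : ℝ) < n := by exact_mod_cast hn
  have hs : 0 < √(n : ℝ) := Real.sqrt_pos.2 hn0
  have hs2 : √(n : ℝ) ^ 2 = n := Real.sq_sqrt hn0.le
  have hterm : ∀ k ∈ Finset.range (n + 1), ((k : ℝ) + 1) * r ^ k * (√((n - k : ℕ) : ℝ))⁻¹ ≤
      2 / √(n : ℝ) * (((k : ℝ) + 1) * r ^ k) +
        4 / ((1 - r) ^ 2 * n) * (√((n - k : ℕ) : ℝ))⁻¹ := by
    intro k hk
    have hk' : k ≤ n := by simp at hk; omega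
    have hu : 0 ≤ ((k : ℝ) + 1) * r ^ k := by positivity
    rcases le_or_gt (2 * k) n with h | h
    · have h1 : (√((n - k : ℕ) : ℝ))⁻¹ ≤ 2 / √(n : ℝ) := by
        rw [inv_le_comm₀ (Real.sqrt_pos.2 (by exact_mod_cast (by omega : 0 < n - k)))
          (by positivity), inv_div]
        apply Real.le_sqrt_of_sq_le
        rw [div_pow, hs2, Nat.cast_sub hk']
        have : (2 * k : ℝ) ≤ n := by exact_mod_cast h
        linarith
      calc _ ≤ ((k : ℝ) + 1) * r ^ k * (2 / √(n : ℝ)) := mul_le_mul_of_nonneg_left h1 hu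
        _ ≤ _ := by
          rw [mul_comm]
          have : 0 ≤ 4 / ((1 - r) ^ 2 * n) * (√((n - k : ℕ) : ℝ))⁻¹ := by positivity
          linarith
    · have h1 : ((k : ℝ) + 1) * r ^ k ≤ 4 / ((1 - r) ^ 2 * n) := by
        rw [le_div_iff₀ (by positivity)]
        have h2 := sq_mul_sq_mul_pow_le_two hr0 hr1.le k
        have h3 : (n : ℝ) ≤ 2 * (k + 1) := by exact_mod_cast (by omega : n ≤ 2 * (k + 1))
        calc ((k : ℝ) + 1) * r ^ k * ((1 - r) ^ 2 * n)
            ≤ ((k : ℝ) + 1) * r ^ k * ((1 - r) ^ 2 * (2 * (k + 1))) := by gcongr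
          _ = 2 * ((1 - r) ^ 2 * (((k : ℝ) + 1) ^ 2 * r ^ k)) := by ring
          _ ≤ 4 := by linarith
      have h4 : 0 ≤ 2 / √(n : ℝ) * (((k : ℝ) + 1) * r ^ k) := by positivity
      have h5 := mul_le_mul_of_nonneg_right h1 (by positivity : 0 ≤ (√((n - k : ℕ) : ℝ))⁻¹)
      linarith
  refine (Finset.sum_le_sum hterm).trans ?_
  rw [Finset.sum_add_distrib, ← Finset.mul_sum, ← Finset.mul_sum]
  have e1 : ∑ k ∈ Finset.range (n + 1), (√((n - k : ℕ) : ℝ))⁻¹ ≤ 2 * √(n : ℝ) := by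
    have := Finset.sum_range_reflect (fun k : ℕ => (√((k : ℕ) : ℝ))⁻¹) (n + 1)
    simp only [Nat.add_sub_cancel] at this
    rw [this]
    exact sum_inv_sqrt_le n
  have e2 : ∑ k ∈ Finset.range (n + 1), ((k : ℝ) + 1) * r ^ k ≤ 1 / (1 - r) ^ 2 := by
    rw [le_div_iff₀ hδ, mul_comm]
    exact sq_mul_sum_succ_mul_pow_le_one hr0 hr1.le _
  calc _ ≤ 2 / √(n : ℝ) * (1 / (1 - r) ^ 2) + 4 / ((1 - r) ^ 2 * n) * (2 * √(n : ℝ)) := by gcongr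
    _ = 10 / ((1 - r) ^ 2 * √(n : ℝ)) := by
      field_simp
      rw [hs2]
      ring

theorem sum_succ_mul_pow_mul_le {r b c : ℝ} (hr0 : 0 ≤ r) (hr1 : r < 1) (hb : 0 ≤ b) (hc : 0 ≤ c)
    {n : ℕ} (hn : 1 ≤ n) :
    ∑ k ∈ Finset.range (n + 1), ((k : ℝ) + 1) * r ^ k *
      (2 * (b / √((n - k : ℕ) : ℝ)) + c * (b / √((n - (k + 1) : ℕ) : ℝ))) ≤
      20 * (1 + c) * b / ((1 - r) ^ 2 * √(n : ℝ)) := by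
  have hterm : ∀ k ∈ Finset.range (n + 1), ((k : ℝ) + 1) * r ^ k *
      (2 * (b / √((n - k : ℕ) : ℝ)) + c * (b / √((n - (k + 1) : ℕ) : ℝ))) ≤
      2 * (1 + c) * b * (((k : ℝ) + 1) * r ^ k * (√((n - k : ℕ) : ℝ))⁻¹) := by
    intro k _
    have h1 : (√((n - (k + 1) : ℕ) : ℝ))⁻¹ ≤ 2 * (√((n - k : ℕ) : ℝ))⁻¹ := by
      rcases Nat.eq_zero_or_pos (n - (k + 1)) with h | h
      · rw [h]; simp
      · rw [← div_eq_mul_inv, inv_le_comm₀ (Real.sqrt_pos.2 (by exact_mod_cast h))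
          (div_pos two_pos (Real.sqrt_pos.2 (by exact_mod_cast (by omega : 0 < n - k)))), inv_div]
        apply Real.le_sqrt_of_sq_le
        rw [div_pow, Real.sq_sqrt (by positivity)]
        have : ((n - k : ℕ) : ℝ) ≤ 4 * ((n - (k + 1) : ℕ) : ℝ) := by
          exact_mod_cast (by omega : n - k ≤ 4 * (n - (k + 1)))
        linarith
    have hu : 0 ≤ ((k : ℝ) + 1) * r ^ k := by positivity
    have h2 := mul_le_mul_of_nonneg_left h1 (mul_nonneg hc hb)
    calc _ ≤ ((k : ℝ) + 1) * r ^ k * (2 * (b * (√((n - k : ℕ) : ℝ))⁻¹) +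
          c * b * (2 * (√((n - k : ℕ) : ℝ))⁻¹)) := by
          refine mul_le_mul_of_nonneg_left ?_ hu
          rw [div_eq_mul_inv, div_eq_mul_inv]
          linarith
      _ = _ := by ring
  refine (Finset.sum_le_sum hterm).trans ?_
  rw [← Finset.mul_sum]
  refine (mul_le_mul_of_nonneg_left (sum_succ_mul_pow_div_sqrt_le hr0 hr1 hn)
    (by positivity)).trans_eq ?_
  ring

section latticeCharFun

variable {ι : Type*}

/-- The characteristic function of the distribution with mass `w i` at the integer `x i`. -/
noncomputable def latticeCharFun (w : ι → ℝ) (x : ι → ℤ) (t : ℝ) : ℂ :=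
  ∑' i, (w i : ℂ) * Complex.exp (Complex.I * x i * t)

variable {w : ι → ℝ} {x : ι → ℤ}

theorem norm_weight_mul_exp (hw : ∀ i, 0 ≤ w i) (t : ℝ) (i : ι) :
    ‖(w i : ℂ) * Complex.exp (Complex.I * x i * t)‖ = w i := by
  rw [norm_mul, norm_exp_I_mul_int_mul, Complex.norm_real, Real.norm_of_nonneg (hw i), mul_one]

theorem continuous_latticeCharFun (hw : ∀ i, 0 ≤ w i) (hw1 : Summable w) :
    Continuous (latticeCharFun w x) :=
  continuous_tsum (fun i => by fun_prop) hw1 fun i t => (norm_weight_mul_exp hw t i).le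

theorem norm_add_mul_exp_le {a b : ℝ} (ha : 0 ≤ a) (hb : 0 ≤ b) (hab : a + b ≤ 1) (k l : ℤ)
    (t : ℝ) :
    ‖(a : ℂ) * Complex.exp (Complex.I * k * t) + b * Complex.exp (Complex.I * l * t)‖ ≤
      a + b - a * b * (1 - Real.cos (((k - l : ℤ) : ℝ) * t)) := by
  set q := a * b * (1 - Real.cos (((k - l : ℤ) : ℝ) * t)) with hq
  have hcos := Real.cos_le_one (((k - l : ℤ) : ℝ) * t)
  have hcos' := Real.neg_one_le_cos (((k - l : ℤ) : ℝ) * t)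
  have hab0 : 0 ≤ a * b := mul_nonneg ha hb
  have hq0 : 0 ≤ q := mul_nonneg hab0 (by linarith)
  have hsq : ‖(a : ℂ) * Complex.exp (Complex.I * k * t) + b * Complex.exp (Complex.I * l * t)‖ ^ 2
      = (a + b) ^ 2 - 2 * q := by
    have e : ∀ m : ℤ, Complex.exp (Complex.I * m * t) =
        Real.cos (m * t) + Real.sin (m * t) * Complex.I := by
      intro m
      rw [Complex.ofReal_cos, Complex.ofReal_sin, ← Complex.exp_mul_I]
      congr 1
      push_cast
      ring
    rw [e, e, ← Complex.normSq_eq_norm_sq, Complex.normSq_apply, hq]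
    have h1 : Real.cos (((k - l : ℤ) : ℝ) * t) = Real.cos (k * t) * Real.cos (l * t) +
        Real.sin (k * t) * Real.sin (l * t) := by
      rw [← Real.cos_sub]; push_cast; ring_nf
    rw [h1]
    simp only [Complex.add_re, Complex.mul_re, Complex.ofReal_re, Complex.ofReal_im, Complex.I_re,
      Complex.I_im, Complex.add_im, Complex.mul_im, mul_zero, zero_mul, mul_one, sub_zero, add_zero,
      zero_add]
    have h2 := Real.sin_sq_add_cos_sq (k * t)
    have h3 := Real.sin_sq_add_cos_sq (l * t)
    linear_combination a ^ 2 * h2 + b ^ 2 * h3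
  have hqab : q ≤ 2 * (a * b) := by nlinarith
  refine abs_le_of_sq_le_sq' ?_ ?_ |>.2
  · rw [hsq]
    nlinarith
  · nlinarith [sq_nonneg (a - b)]

theorem norm_latticeCharFun_le_pair (hw : ∀ i, 0 ≤ w i) (hw1 : HasSum w 1) {i j : ι} (hij : i ≠ j)
    (t : ℝ) : ‖latticeCharFun w x t‖ ≤
      1 - w i * w j * (1 - Real.cos (((x i - x j : ℤ) : ℝ) * t)) := by
  classical
  have hs : Summable fun i => ‖(w i : ℂ) * Complex.exp (Complex.I * x i * t)‖ := by
    simpa only [norm_weight_mul_exp hw] using hw1.summable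
  have e1 := hs.of_norm.sum_add_tsum_compl (s := {i, j})
  have e2 := hw1.summable.sum_add_tsum_compl (s := {i, j})
  rw [hw1.tsum_eq, Finset.sum_pair hij] at e2
  rw [Finset.sum_pair hij] at e1
  have h3 : ‖∑' k : ↥((({i, j} : Finset ι) : Set ι)ᶜ),
      (w k : ℂ) * Complex.exp (Complex.I * x k * t)‖ ≤
      ∑' k : ↥((({i, j} : Finset ι) : Set ι)ᶜ), w k := by
    refine (norm_tsum_le_tsum_norm (hs.subtype _)).trans_eq ?_
    simp only [norm_weight_mul_exp hw]
  have h4 : 0 ≤ ∑' k : ↥((({i, j} : Finset ι) : Set ι)ᶜ), w k := tsum_nonneg fun k => hw k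
  have h5 := norm_add_mul_exp_le (hw i) (hw j) (by linarith) (x i) (x j) t
  rw [latticeCharFun, ← e1]
  refine (norm_add_le _ _).trans ?_
  linarith

theorem exists_norm_latticeCharFun_le (hw : ∀ i, 0 ≤ w i) (hw1 : HasSum w 1) {i₀ i₁ : ι}
    (hi₀ : w i₀ ≠ 0) (hi₁ : w i₁ ≠ 0) (hne : x i₀ ≠ x i₁) :
    ∃ d : ℕ, 1 ≤ d ∧ (∀ i, w i ≠ 0 → (d : ℤ) ∣ x i - x i₀) ∧
      ∃ c : ℝ, 0 < c ∧ ∀ t : ℝ, |t| ≤ Real.pi / d → ‖latticeCharFun w x t‖ ≤ 1 - c * t ^ 2 := by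
  have hpi := Real.pi_pos
  obtain ⟨a, ha⟩ := Int.subgroup_cyclic (AddSubgroup.closure {m | ∃ i, w i ≠ 0 ∧ m = x i - x i₀})
  have hdvd : ∀ i, w i ≠ 0 → a ∣ x i - x i₀ := by
    intro i hi
    have h : x i - x i₀ ∈ AddSubgroup.closure {a} := ha ▸ AddSubgroup.subset_closure ⟨i, hi, rfl⟩
    obtain ⟨k, hk⟩ := AddSubgroup.mem_closure_singleton.1 h
    exact ⟨k, by rw [← hk, smul_eq_mul, mul_comm]⟩
  have ha0 : a ≠ 0 := by
    rintro rfl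
    have := hdvd i₁ hi₁
    rw [zero_dvd_iff, sub_eq_zero] at this
    exact hne this.symm
  refine ⟨a.natAbs, Int.natAbs_pos.2 ha0, fun i hi => Int.natAbs_dvd.2 (hdvd i hi), ?_⟩
  set d := a.natAbs with hd
  have hd1 : 1 ≤ d := Int.natAbs_pos.2 ha0
  have hd1' : (1 : ℝ) ≤ d := by exact_mod_cast hd1
  have hda : |(a : ℝ)| = d := by rw [hd, Nat.cast_natAbs]; simp
  have hlt : ∀ t : ℝ, t ≠ 0 → |t| ≤ Real.pi / d → ‖latticeCharFun w x t‖ < 1 := by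
    intro t ht0 ht
    by_contra! hcon
    have hcos : ∀ i, w i ≠ 0 → Real.cos (((x i - x i₀ : ℤ) : ℝ) * t) = 1 := by
      intro i hi
      by_cases h : i = i₀
      · subst h; simp
      have h1 := hcon.trans (norm_latticeCharFun_le_pair (x := x) hw hw1 h t)
      have h2 : 0 < w i * w i₀ :=
        mul_pos ((hw i).lt_of_ne hi.symm) ((hw i₀).lt_of_ne hi₀.symm)
      have h3 := Real.cos_le_one (((x i - x i₀ : ℤ) : ℝ) * t)
      nlinarith
    have hmem : a ∈ AddSubgroup.closure {m | ∃ i, w i ≠ 0 ∧ m = x i - x i₀} := by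
      rw [ha]; exact AddSubgroup.mem_closure_singleton_self a
    have hall : ∀ m ∈ AddSubgroup.closure {m | ∃ i, w i ≠ 0 ∧ m = x i - x i₀},
        ∃ l : ℤ, (l : ℝ) * (2 * Real.pi) = (m : ℝ) * t := by
      intro m hm
      induction hm using AddSubgroup.closure_induction with
      | mem m hm =>
        obtain ⟨i, hi, rfl⟩ := hm
        exact (Real.cos_eq_one_iff _).1 (hcos i hi)
      | zero => exact ⟨0, by simp⟩
      | add u v _ _ hu hv =>
        obtain ⟨l, hl⟩ := hu
        obtain ⟨l', hl'⟩ := hv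
        exact ⟨l + l', by push_cast; linear_combination hl + hl'⟩
      | neg u _ hu =>
        obtain ⟨l, hl⟩ := hu
        exact ⟨-l, by push_cast; linear_combination -hl⟩
    obtain ⟨l, hl⟩ := hall a hmem
    have h1 : |(l : ℝ)| * (2 * Real.pi) ≤ Real.pi := by
      rw [← abs_of_pos (by positivity : 0 < 2 * Real.pi), ← abs_mul, hl, abs_mul, hda]
      rwa [le_div_iff₀ (by linarith), mul_comm] at ht
    have h2 : |(l : ℝ)| < 1 := by nlinarith [abs_nonneg (l : ℝ)]
    have h3 : l = 0 := by
      rw [← Int.abs_lt_one_iff]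
      exact_mod_cast h2
    rw [h3, Int.cast_zero, zero_mul] at hl
    exact (mul_ne_zero (by exact_mod_cast ha0) ht0) hl.symm
  set m : ℤ := x i₀ - x i₁ with hm
  have hm0 : m ≠ 0 := sub_ne_zero.2 hne
  have hm1 : (1 : ℝ) ≤ |(m : ℝ)| := by exact_mod_cast Int.one_le_abs hm0
  have hww : 0 < w i₀ * w i₁ := mul_pos ((hw _).lt_of_ne hi₀.symm) ((hw _).lt_of_ne hi₁.symm)
  have hnear : ∀ t : ℝ, |t| ≤ Real.pi / |(m : ℝ)| →
      ‖latticeCharFun w x t‖ ≤ 1 - w i₀ * w i₁ * (2 / Real.pi ^ 2) * t ^ 2 := by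
    intro t ht
    refine (norm_latticeCharFun_le_pair hw hw1 (ne_of_apply_ne x hne) t).trans ?_
    have h1 : |(m : ℝ) * t| ≤ Real.pi := by
      rw [abs_mul, mul_comm]; rwa [le_div_iff₀ (by linarith)] at ht
    have h2 := Real.cos_le_one_sub_mul_cos_sq h1
    have h3 : t ^ 2 ≤ ((m : ℝ) * t) ^ 2 := by
      rw [mul_pow, ← sq_abs (m : ℝ)]
      exact le_mul_of_one_le_left (sq_nonneg t) (one_le_pow₀ hm1)
    have h4 : 2 / Real.pi ^ 2 * t ^ 2 ≤ 1 - Real.cos ((m : ℝ) * t) := by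
      have : 2 / Real.pi ^ 2 * t ^ 2 ≤ 2 / Real.pi ^ 2 * ((m : ℝ) * t) ^ 2 := by gcongr
      linarith
    have h5 := mul_le_mul_of_nonneg_left h4 hww.le
    rw [← hm]
    linarith
  have hcpt : IsCompact {t : ℝ | |t| ≤ Real.pi / d ∧ Real.pi / |(m : ℝ)| ≤ |t|} := by
    refine Metric.isCompact_of_isClosed_isBounded ?_ ?_
    · exact (isClosed_le continuous_abs continuous_const).inter
        (isClosed_le continuous_const continuous_abs)
    · refine (Metric.isBounded_closedBall (x := (0 : ℝ)) (r := Real.pi / d)).subset fun t ht => ?_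
      simpa using ht.1
  have hcont := (continuous_latticeCharFun (x := x) hw hw1.summable).norm
  obtain ⟨ρ, hρ1, hρ⟩ : ∃ ρ < 1, ∀ t : ℝ, |t| ≤ Real.pi / d → Real.pi / |(m : ℝ)| ≤ |t| →
      ‖latticeCharFun w x t‖ ≤ ρ := by
    rcases Set.eq_empty_or_nonempty {t : ℝ | |t| ≤ Real.pi / d ∧ Real.pi / |(m : ℝ)| ≤ |t|}
      with h | h
    · exact ⟨0, zero_lt_one, fun t h1 h2 =>
        absurd (show t ∈ (∅ : Set ℝ) from h ▸ ⟨h1, h2⟩) (by simp)⟩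
    · obtain ⟨t₀, ht₀, hmax⟩ := hcpt.exists_isMaxOn h hcont.continuousOn
      refine ⟨_, hlt t₀ ?_ ht₀.1, fun t h1 h2 => hmax ⟨h1, h2⟩⟩
      rintro rfl
      have := ht₀.2
      rw [abs_zero] at this
      exact absurd this (not_le.2 (by positivity))
  refine ⟨min (w i₀ * w i₁ * (2 / Real.pi ^ 2)) ((1 - ρ) / Real.pi ^ 2),
    lt_min (by positivity) (div_pos (by linarith) (by positivity)), fun t ht => ?_⟩
  rcases le_total (|t|) (Real.pi / |(m : ℝ)|) with h | h
  · refine (hnear t h).trans ?_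
    gcongr
    exact min_le_left _ _
  · refine (hρ t ht h).trans ?_
    have h1 : t ^ 2 ≤ Real.pi ^ 2 := by
      rw [sq_le_sq, abs_of_pos hpi]
      exact ht.trans (div_le_self hpi.le hd1')
    have h2 : min (w i₀ * w i₁ * (2 / Real.pi ^ 2)) ((1 - ρ) / Real.pi ^ 2) * t ^ 2 ≤
        (1 - ρ) / Real.pi ^ 2 * Real.pi ^ 2 := by
      have : 0 ≤ (1 - ρ) / Real.pi ^ 2 := div_nonneg (by linarith) (by positivity)
      gcongr
      exact min_le_right _ _
    rw [div_mul_cancel₀ _ (by positivity)] at h2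
    linarith

end latticeCharFun

section inversion

open PowerSeries

variable {Φ : PowerSeries ℝ}

theorem hasSum_coeff_pow_mul (hΦ : ∀ n, 0 ≤ coeff n Φ) (hΦ1 : Summable fun n => coeff n Φ) {z : ℂ}
    (hz : ‖z‖ ≤ 1) (n : ℕ) :
    (Summable fun j => ‖((coeff j (Φ ^ n) : ℝ) : ℂ) * z ^ j‖) ∧
      ∑' j, ((coeff j (Φ ^ n) : ℝ) : ℂ) * z ^ j = (∑' j, ((coeff j Φ : ℝ) : ℂ) * z ^ j) ^ n := by
  have h1 : Summable fun j => ‖((coeff j Φ : ℝ) : ℂ) * z ^ j‖ := by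
    refine Summable.of_nonneg_of_le (fun _ => norm_nonneg _) (fun j => ?_) hΦ1
    rw [norm_mul, Complex.norm_real, Real.norm_of_nonneg (hΦ j), norm_pow]
    exact mul_le_of_le_one_right (hΦ j) (pow_le_one₀ (norm_nonneg _) hz)
  induction n with
  | zero =>
    have h0 : ∀ j : ℕ, j ≠ 0 → ((coeff j ((Φ : PowerSeries ℝ) ^ 0) : ℝ) : ℂ) * z ^ j = 0 := by
      intro j hj
      simp [coeff_one, hj]
    refine ⟨summable_of_ne_finset_zero (s := {0}) fun j hj => ?_, ?_⟩
    · rw [h0 j (by simpa using hj), norm_zero]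
    · rw [tsum_eq_single 0 h0]
      simp
  | succ n ih =>
    obtain ⟨ih1, ih2⟩ := ih
    set f : ℕ → ℂ := fun j => ((coeff j (Φ ^ n) : ℝ) : ℂ) * z ^ j with hf
    set g : ℕ → ℂ := fun j => ((coeff j Φ : ℝ) : ℂ) * z ^ j with hg
    have e : (fun j => ((coeff j (Φ ^ (n + 1)) : ℝ) : ℂ) * z ^ j) =
        fun j => ∑ kl ∈ Finset.HasAntidiagonal.antidiagonal j, f kl.1 * g kl.2 := by
      funext j
      rw [pow_succ, coeff_mul, Complex.ofReal_sum, Finset.sum_mul]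
      refine Finset.sum_congr rfl fun kl hkl => ?_
      rw [← Finset.HasAntidiagonal.mem_antidiagonal.1 hkl, pow_add, hf, hg]
      push_cast
      ring
    have h2 := summable_norm_sum_mul_antidiagonal_of_summable_norm ih1 h1
    have h3 := tsum_mul_tsum_eq_tsum_sum_antidiagonal_of_summable_norm ih1 h1
    rw [ih2, ← pow_succ] at h3
    rw [h3, ← e]
    refine ⟨?_, rfl⟩
    refine h2.congr fun j => ?_
    rw [congrFun e j]

theorem coeff_pow_eq_zero_of_not_dvd {d : ℕ} (hd : ∀ k, coeff k Φ ≠ 0 → d ∣ k) (n : ℕ) {j : ℕ}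
    (hj : ¬ d ∣ j) : coeff j (Φ ^ n) = 0 := by
  induction n generalizing j with
  | zero =>
    rw [pow_zero, coeff_one, if_neg]
    rintro rfl
    exact hj (dvd_zero d)
  | succ n ih =>
    rw [pow_succ, coeff_mul]
    refine Finset.sum_eq_zero fun kl hkl => ?_
    have h := Finset.HasAntidiagonal.mem_antidiagonal.1 hkl
    by_cases h1 : d ∣ kl.1
    · have h2 : ¬ d ∣ kl.2 := fun h2 => hj (h ▸ dvd_add h1 h2)
      rw [not_imp_comm.1 (hd kl.2) h2, mul_zero]
    · rw [ih h1, zero_mul]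

theorem integral_exp_int_mul {d : ℕ} (hd : 1 ≤ d) {m : ℤ} (hm : (d : ℤ) ∣ m) :
    ∫ t in (-(Real.pi / d))..(Real.pi / d), Complex.exp (Complex.I * m * t) =
      if m = 0 then ((2 * Real.pi / d : ℝ) : ℂ) else 0 := by
  split_ifs with h
  · subst h
    simp only [Int.cast_zero, mul_zero, zero_mul, Complex.exp_zero, intervalIntegral.integral_const,
      sub_neg_eq_add, Complex.real_smul, mul_one]
    congr 1
    ring
  · have hc : Complex.I * m ≠ 0 := mul_ne_zero Complex.I_ne_zero (by exact_mod_cast h)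
    have hd0 : (d : ℂ) ≠ 0 := by exact_mod_cast (by omega : d ≠ 0)
    rw [integral_exp_mul_complex hc, div_eq_zero_iff]
    left
    rw [sub_eq_zero, Complex.exp_eq_exp_iff_exists_int]
    obtain ⟨k, rfl⟩ := hm
    refine ⟨k, ?_⟩
    push_cast
    field_simp
    ring

/-- The characteristic function of the distribution with generating function `Φ`. -/
noncomputable def seriesCharFun (Φ : PowerSeries ℝ) (t : ℝ) : ℂ :=
  latticeCharFun (fun k => coeff k Φ) (fun k : ℕ => (k : ℤ)) t

theorem seriesCharFun_pow (hΦ : ∀ n, 0 ≤ coeff n Φ) (hΦ1 : Summable fun n => coeff n Φ) (n : ℕ)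
    (t : ℝ) : (Summable fun j => coeff j (Φ ^ n)) ∧
      seriesCharFun Φ t ^ n =
        ∑' j : ℕ, ((coeff j (Φ ^ n) : ℝ) : ℂ) * Complex.exp (Complex.I * j * t) := by
  have e : ∀ j : ℕ, Complex.exp (Complex.I * j * t) = Complex.exp (Complex.I * t) ^ j := by
    intro j
    rw [← Complex.exp_nat_mul]
    congr 1
    ring
  have hz : ‖Complex.exp (Complex.I * t)‖ = 1 := by
    rw [mul_comm]
    exact Complex.norm_exp_ofReal_mul_I t
  have h := hasSum_coeff_pow_mul hΦ hΦ1 hz.le n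
  refine ⟨?_, ?_⟩
  · simpa [norm_mul, hz, abs_of_nonneg (coeff_pow_nonneg hΦ n _)] using h.1
  · simp only [seriesCharFun, latticeCharFun, Int.cast_natCast, e]
    exact h.2.symm

theorem coeff_pow_eq_integral (hΦ : ∀ n, 0 ≤ coeff n Φ) (hΦ1 : Summable fun n => coeff n Φ)
    {d : ℕ} (hd1 : 1 ≤ d) (hd : ∀ k, coeff k Φ ≠ 0 → d ∣ k) (n : ℕ) {j : ℕ} (hj : d ∣ j) :
    (2 * Real.pi / d : ℝ) * ((coeff j (Φ ^ n) : ℝ) : ℂ) =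
      ∫ t in (-(Real.pi / d))..(Real.pi / d),
        seriesCharFun Φ t ^ n * Complex.exp (-(Complex.I * j * t)) := by
  have hs := (seriesCharFun_pow hΦ hΦ1 n 0).1
  have key : HasSum (fun k : ℕ => ∫ t in (-(Real.pi / d))..(Real.pi / d),
      ((coeff k (Φ ^ n) : ℝ) : ℂ) * Complex.exp (Complex.I * ((k - j : ℤ) : ℂ) * t))
      (∫ t in (-(Real.pi / d))..(Real.pi / d),
        seriesCharFun Φ t ^ n * Complex.exp (-(Complex.I * j * t))) := by
    refine intervalIntegral.hasSum_integral_of_dominated_convergence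
      (fun k _ => coeff k (Φ ^ n)) ?_ ?_ ?_ ?_ ?_
    · intro k
      exact (by fun_prop : Continuous _).aestronglyMeasurable
    · intro k
      filter_upwards with t _
      rw [norm_mul, norm_exp_I_mul_int_mul, mul_one, Complex.norm_real,
        Real.norm_of_nonneg (coeff_pow_nonneg hΦ n k)]
    · filter_upwards with t _ using hs
    · simp
    · filter_upwards with t _
      have h := seriesCharFun_pow hΦ hΦ1 n t
      have hsum : Summable fun k : ℕ =>
          ((coeff k (Φ ^ n) : ℝ) : ℂ) * Complex.exp (Complex.I * k * t) := by
        refine Summable.of_norm ?_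
        refine hs.congr fun k => ?_
        have := norm_exp_I_mul_int_mul k t
        rw [Int.cast_natCast] at this
        rw [norm_mul, this, mul_one, Complex.norm_real,
          Real.norm_of_nonneg (coeff_pow_nonneg hΦ n k)]
      rw [h.2]
      refine (hsum.hasSum.mul_right (Complex.exp (-(Complex.I * j * t)))).congr_fun fun k => ?_
      rw [mul_assoc (_ : ℂ) (Complex.exp _), ← Complex.exp_add]
      congr 2
      push_cast
      ring
  rw [← key.tsum_eq, tsum_eq_single j]
  · rw [intervalIntegral.integral_const_mul, integral_exp_int_mul hd1 (by simp)]
    simp [mul_comm]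
  · intro k hk
    rw [intervalIntegral.integral_const_mul]
    by_cases hdk : d ∣ k
    · rw [integral_exp_int_mul hd1 (dvd_sub (by exact_mod_cast hdk) (by exact_mod_cast hj)),
        if_neg (by omega), mul_zero]
    · rw [coeff_pow_eq_zero_of_not_dvd hd n hdk]
      simp

end inversion

section offspring

open PowerSeries Filter Topology MeasureTheory

theorem hasSum_toReal_of_tsum_eq {α : Type*} {f : α → ℝ≥0∞} {a : ℝ≥0∞} (h : ∑' i, f i = a)
    (ha : a ≠ ⊤) : HasSum (fun i => (f i).toReal) a.toReal := by
  have h1 : ∑' i, f i ≠ ⊤ := h ▸ ha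
  have h2 := ENNReal.hasSum_toReal h1
  rwa [← ENNReal.tsum_toReal_eq (fun i => ENNReal.ne_top_of_tsum_ne_top h1 i), h] at h2

variable {p : ℕ → ℝ≥0∞}

theorem hasSum_offspring (hp : ∑' k : ℕ, p k = 1) : HasSum (fun k => (p k).toReal) 1 := by
  simpa using hasSum_toReal_of_tsum_eq hp ENNReal.one_ne_top

theorem hasSum_offspring_mean (hmean : ∑' k : ℕ, (k : ℝ≥0∞) * p k = 1) :
    HasSum (fun k : ℕ => (k : ℝ) * (p k).toReal) 1 := by
  simpa using hasSum_toReal_of_tsum_eq hmean ENNReal.one_ne_top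

theorem hasSum_offspring_var (hvar : xiVar p ≠ ⊤) :
    HasSum (fun k : ℕ => (p k).toReal * ((k : ℝ) - 1) ^ 2) (xiVar p).toReal := by
  have := hasSum_toReal_of_tsum_eq (f := fun k : ℕ => p k * ENNReal.ofReal (((k : ℝ) - 1) ^ 2)) rfl
    hvar
  simpa [xiVar, ENNReal.toReal_mul, ENNReal.toReal_ofReal (sq_nonneg _)] using this

theorem PMF.integrable_of_summable {α E : Type*} [Countable α] [MeasurableSpace α]
    [MeasurableSingletonClass α] [NormedAddCommGroup E] (P : PMF α) {f : α → E}
    (hf : Summable fun a => (P a).toReal * ‖f a‖) : Integrable f P.toMeasure := by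
  refine ⟨(StronglyMeasurable.of_discrete).aestronglyMeasurable, ?_⟩
  rw [HasFiniteIntegral, lintegral_countable']
  have e : ∀ a, ‖f a‖ₑ * P.toMeasure {a} = ENNReal.ofReal ((P a).toReal * ‖f a‖) := by
    intro a
    rw [PMF.toMeasure_apply_singleton P a (MeasurableSet.singleton a),
      ENNReal.ofReal_mul ENNReal.toReal_nonneg, ENNReal.ofReal_toReal (P.apply_ne_top a),
      ofReal_norm, mul_comm]
  simp only [e]
  rw [← ENNReal.ofReal_tsum_of_nonneg (fun a => by positivity) hf]
  exact ENNReal.ofReal_lt_top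

theorem tendsto_seriesCharFun_pow (hp : ∑' k : ℕ, p k = 1)
    (hmean : ∑' k : ℕ, (k : ℝ≥0∞) * p k = 1) (hvar0 : 0 < xiVar p) (hvar : xiVar p ≠ ⊤) (s : ℝ) :
    Tendsto (fun n : ℕ => (seriesCharFun (offspringSeries p) ((√(n : ℝ))⁻¹ * s) *
        Complex.exp (-(Complex.I * ((√(n : ℝ))⁻¹ * s : ℝ)))) ^ n) atTop
      (𝓝 (Complex.exp (-((xiVar p).toReal / 2 * s ^ 2 : ℝ)))) := by
  set v := (xiVar p).toReal with hv
  have hv0 : 0 < v := ENNReal.toReal_pos hvar0.ne' hvar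
  have hsv : 0 < √v := Real.sqrt_pos.2 hv0
  have hsv2 : √v ^ 2 = v := Real.sq_sqrt hv0.le
  have h0 := hasSum_offspring hp
  have h1 := hasSum_offspring_mean hmean
  have h2 := hasSum_offspring_var hvar
  let P : PMF ℕ := ⟨p, by rw [← hp]; exact ENNReal.summable.hasSum⟩
  have hP : ∀ k, P k = p k := fun _ => rfl
  have hPm : IsProbabilityMeasure P.toMeasure := inferInstance
  let Y : ℕ → ℝ := fun k => ((k : ℝ) - 1) / √v
  have hY1 : HasSum (fun k => (P k).toReal * Y k) 0 := by
    have := ((h1.sub h0).div_const (√v))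
    rw [sub_self, zero_div] at this
    refine this.congr_fun fun k => ?_
    simp only [hP, Y]
    ring
  have hY2 : HasSum (fun k => (P k).toReal * Y k ^ 2) 1 := by
    have := h2.div_const v
    rw [← hv, div_self hv0.ne'] at this
    refine this.congr_fun fun k => ?_
    simp only [hP, Y, div_pow, hsv2]
    ring
  have hYi : Integrable Y P.toMeasure := by
    refine PMF.integrable_of_summable P ?_
    simpa [abs_of_nonneg] using hY1.summable.norm
  have hYi2 : Integrable (Y ^ 2) P.toMeasure := by
    refine PMF.integrable_of_summable P ?_
    simpa using hY2.summable
  have key := ProbabilityTheory.tendsto_charFun_inv_sqrt_mul_pow (P := P.toMeasure) (X := Y)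
    (measurable_of_countable Y).aemeasurable
    (by rw [PMF.integral_eq_tsum _ _ hYi]; simpa using hY1.tsum_eq)
    (by rw [PMF.integral_eq_tsum _ _ hYi2]; simpa using hY2.tsum_eq) (√v * s)
  convert key using 2
  · rename_i n
    congr 1
    rw [charFun_apply_real, integral_map (measurable_of_countable Y).aemeasurable
      (by fun_prop), PMF.integral_eq_tsum]
    · rw [seriesCharFun, latticeCharFun, ← tsum_mul_right]
      refine tsum_congr fun k => ?_
      rw [mul_assoc, ← Complex.exp_add, Complex.real_smul, offspringSeries, coeff_mk]
      congr 2
      have : (√v : ℂ) ≠ 0 := by exact_mod_cast hsv.ne'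
      simp only [Y]
      push_cast
      field_simp
      ring
    · refine PMF.integrable_of_summable P ?_
      have : ∀ x y : ℝ, ‖Complex.exp (x * y * Complex.I)‖ = 1 := by
        intro x y
        rw [← Complex.ofReal_mul]
        exact Complex.norm_exp_ofReal_mul_I _
      simpa only [this, mul_one, hP] using h0.summable
  · rw [← Complex.ofReal_pow, mul_pow, hsv2]
    push_cast
    ring_nf

end offspring

section localLimit

open PowerSeries Filter Topology MeasureTheory

variable {Φ : PowerSeries ℝ}

theorem pow_le_exp_neg {a x : ℝ} (ha : 0 ≤ a) (h : a ≤ 1 - x) (n : ℕ) :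
    a ^ n ≤ Real.exp (-(n * x)) := by
  refine (pow_le_pow_left₀ ha (h.trans (Real.one_sub_le_exp_neg x)) n).trans_eq ?_
  rw [← Real.exp_nat_mul, mul_neg]

theorem norm_exp_neg_I_mul (x : ℝ) : ‖Complex.exp (-(Complex.I * x))‖ = 1 := by
  rw [show -(Complex.I * x) = ((-x : ℝ) : ℂ) * Complex.I by push_cast; ring]
  exact Complex.norm_exp_ofReal_mul_I _

theorem continuous_seriesCharFun (hΦ : ∀ n, 0 ≤ coeff n Φ) (hΦ1 : Summable fun n => coeff n Φ) :
    Continuous (seriesCharFun Φ) :=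
  continuous_latticeCharFun hΦ hΦ1

/-- Fourier inversion after rescaling the variable by `√n`. -/
theorem sqrt_mul_coeff_pow_eq_integral (hΦ : ∀ n, 0 ≤ coeff n Φ)
    (hΦ1 : Summable fun n => coeff n Φ) {d : ℕ} (hd1 : 1 ≤ d)
    (hd : ∀ k, coeff k Φ ≠ 0 → d ∣ k) {n : ℕ} (hn : 1 ≤ n) {j : ℕ} (hj : d ∣ j) :
    (√(n : ℝ) * (2 * Real.pi / d * coeff j (Φ ^ n)) : ℝ) =
      ∫ s : ℝ, (Ioc (-(√(n : ℝ) * (Real.pi / d))) (√(n : ℝ) * (Real.pi / d))).indicator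
        (fun s => seriesCharFun Φ ((√(n : ℝ))⁻¹ * s) ^ n *
          Complex.exp (-(Complex.I * (j * ((√(n : ℝ))⁻¹ * s) : ℝ)))) s := by
  have hs : 0 < √(n : ℝ) := Real.sqrt_pos.2 (by exact_mod_cast hn)
  have hpi : 0 ≤ Real.pi / d := by positivity
  rw [integral_indicator measurableSet_Ioc, ← intervalIntegral.integral_of_le
    (by nlinarith [mul_nonneg hs.le hpi]),
    intervalIntegral.integral_comp_mul_left
      (fun t => seriesCharFun Φ t ^ n * Complex.exp (-(Complex.I * (j * t : ℝ))))
      (inv_ne_zero hs.ne'), inv_inv, mul_neg, inv_mul_cancel_left₀ hs.ne', Complex.real_smul]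
  have h := coeff_pow_eq_integral hΦ hΦ1 hd1 hd n hj
  rw [Complex.ofReal_mul, Complex.ofReal_mul (2 * Real.pi / d), h]
  congr 2
  funext t
  push_cast
  ring_nf

theorem norm_indicator_le {d : ℕ} {c : ℝ}
    (hc : ∀ t : ℝ, |t| ≤ Real.pi / d → ‖seriesCharFun Φ t‖ ≤ 1 - c * t ^ 2) {n : ℕ} (hn : 1 ≤ n)
    (j : ℕ) (s : ℝ) :
    ‖(Ioc (-(√(n : ℝ) * (Real.pi / d))) (√(n : ℝ) * (Real.pi / d))).indicator
        (fun s => seriesCharFun Φ ((√(n : ℝ))⁻¹ * s) ^ n *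
          Complex.exp (-(Complex.I * (j * ((√(n : ℝ))⁻¹ * s) : ℝ)))) s‖ ≤
      Real.exp (-c * s ^ 2) := by
  have hn0 : (0 : ℝ) < n := by exact_mod_cast hn
  have hs : 0 < √(n : ℝ) := Real.sqrt_pos.2 hn0
  by_cases h : s ∈ Ioc (-(√(n : ℝ) * (Real.pi / d))) (√(n : ℝ) * (Real.pi / d))
  · rw [indicator_of_mem h, norm_mul, norm_exp_neg_I_mul, mul_one, norm_pow]
    have h1 : |(√(n : ℝ))⁻¹ * s| ≤ Real.pi / d := by
      rw [abs_mul, abs_of_pos (inv_pos.2 hs), inv_mul_le_iff₀ hs]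
      exact abs_le.2 ⟨h.1.le, h.2⟩
    refine (pow_le_exp_neg (norm_nonneg _) (hc _ h1) n).trans_eq ?_
    congr 1
    rw [mul_pow, inv_pow, Real.sq_sqrt hn0.le]
    field_simp
  · rw [indicator_of_notMem h, norm_zero]
    exact (Real.exp_pos _).le

theorem coeff_pow_le_div_sqrt (hΦ : ∀ n, 0 ≤ coeff n Φ)
    (hΦ1 : Summable fun n => coeff n Φ) {d : ℕ} (hd1 : 1 ≤ d)
    (hd : ∀ k, coeff k Φ ≠ 0 → d ∣ k) {c : ℝ} (hc0 : 0 < c)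
    (hc : ∀ t : ℝ, |t| ≤ Real.pi / d → ‖seriesCharFun Φ t‖ ≤ 1 - c * t ^ 2) {n : ℕ} (hn : 1 ≤ n)
    (j : ℕ) : coeff j (Φ ^ n) ≤ d / (2 * Real.pi) * √(Real.pi / c) / √(n : ℝ) := by
  have hn0 : (0 : ℝ) < n := by exact_mod_cast hn
  have hd0 : (0 : ℝ) < d := by exact_mod_cast hd1
  have hpi := Real.pi_pos
  have hs : 0 < √(n : ℝ) := Real.sqrt_pos.2 hn0
  by_cases hj : d ∣ j
  · have h := norm_integral_le_of_norm_le (integrable_exp_neg_mul_sq hc0)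
      (Eventually.of_forall (norm_indicator_le hc hn j))
    rw [← sqrt_mul_coeff_pow_eq_integral hΦ hΦ1 hd1 hd hn hj, Complex.norm_real,
      integral_gaussian] at h
    have h2 := (Real.le_norm_self _).trans h
    rw [le_div_iff₀ hs]
    calc coeff j (Φ ^ n) * √(n : ℝ)
        = d / (2 * Real.pi) * (√(n : ℝ) * (2 * Real.pi / d * coeff j (Φ ^ n))) := by
          field_simp
      _ ≤ _ := by gcongr
  · rw [coeff_pow_eq_zero_of_not_dvd hd n hj]
    positivity

theorem exists_pos_forall_lt_le (f : ℕ → ℝ) (N : ℕ) :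
    ∃ c : ℝ, 0 < c ∧ ∀ n < N, 0 < f n → c ≤ f n := by
  induction N with
  | zero => exact ⟨1, one_pos, by simp⟩
  | succ N ih =>
    obtain ⟨c, hc, h⟩ := ih
    refine ⟨if 0 < f N then min c (f N) else c, by split_ifs with h1; exacts [lt_min hc h1, hc],
      fun n hn hfn => ?_⟩
    rcases Nat.lt_succ_iff_lt_or_eq.1 hn with h1 | rfl
    · refine le_trans ?_ (h n h1 hfn)
      split_ifs
      exacts [min_le_left _ _, le_rfl]
    · rw [if_pos hfn]
      exact min_le_right _ _

variable {p : ℕ → ℝ≥0∞}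

theorem exists_div_sqrt_le_coeff_pow (hp : ∑' k : ℕ, p k = 1)
    (hmean : ∑' k : ℕ, (k : ℝ≥0∞) * p k = 1) (hvar0 : 0 < xiVar p) (hvar : xiVar p ≠ ⊤)
    {d : ℕ} (hd1 : 1 ≤ d) (hd : ∀ k, coeff k (offspringSeries p) ≠ 0 → d ∣ k) {c : ℝ} (hc0 : 0 < c)
    (hc : ∀ t : ℝ, |t| ≤ Real.pi / d → ‖seriesCharFun (offspringSeries p) t‖ ≤ 1 - c * t ^ 2) :
    ∃ a : ℝ, 0 < a ∧ ∀ n : ℕ, 1 ≤ n → coeff (n - 1) (offspringSeries p ^ n) ≠ 0 →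
      a / √(n : ℝ) ≤ coeff (n - 1) (offspringSeries p ^ n) := by
  set Φ := offspringSeries p with hΦd
  have hΦ : ∀ n, 0 ≤ coeff n Φ := coeff_offspringSeries_nonneg
  have hΦ1 : Summable fun n => coeff n Φ := by
    simpa [hΦd, offspringSeries] using (hasSum_offspring hp).summable
  have hd0 : (0 : ℝ) < d := by exact_mod_cast hd1
  have hpi := Real.pi_pos
  set v := (xiVar p).toReal with hv
  have hv0 : 0 < v := ENNReal.toReal_pos hvar0.ne' hvar
  have hlim : Tendsto (fun n : ℕ => ∫ s : ℝ,
      (Ioc (-(√(n : ℝ) * (Real.pi / d))) (√(n : ℝ) * (Real.pi / d))).indicator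
        (fun s => seriesCharFun Φ ((√(n : ℝ))⁻¹ * s) ^ n *
          Complex.exp (-(Complex.I * ((n - 1 : ℕ) * ((√(n : ℝ))⁻¹ * s) : ℝ)))) s) atTop
      (𝓝 (∫ s : ℝ, Complex.exp (-(v / 2 * s ^ 2 : ℝ)))) := by
    refine tendsto_integral_filter_of_dominated_convergence (fun s => Real.exp (-c * s ^ 2))
      ?_ ?_ (integrable_exp_neg_mul_sq hc0) ?_
    · refine Eventually.of_forall fun n => ?_
      have h1 := continuous_seriesCharFun hΦ hΦ1
      exact ((by fun_prop : Continuous _).aestronglyMeasurable).indicator measurableSet_Ioc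
    · filter_upwards [eventually_ge_atTop 1] with n hn
      exact Eventually.of_forall (norm_indicator_le hc hn (n - 1))
    · refine Eventually.of_forall fun s => ?_
      have hsq : Tendsto (fun n : ℕ => √(n : ℝ)) atTop atTop :=
        Real.tendsto_sqrt_atTop.comp tendsto_natCast_atTop_atTop
      have h1 : Tendsto (fun n : ℕ => (√(n : ℝ))⁻¹ * s) atTop (𝓝 0) := by
        simpa using (tendsto_inv_atTop_zero.comp hsq).mul_const s
      have h2 : Tendsto (fun n : ℕ => Complex.exp (Complex.I * ((√(n : ℝ))⁻¹ * s : ℝ))) atTop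
          (𝓝 1) := by
        have : Continuous fun x : ℝ => Complex.exp (Complex.I * x) := by fun_prop
        have h := (this.tendsto 0).comp h1
        simp only [Complex.ofReal_zero, mul_zero, Complex.exp_zero] at h
        exact h
      have h3 := (tendsto_seriesCharFun_pow hp hmean hvar0 hvar s).mul h2
      rw [mul_one] at h3
      refine h3.congr' ?_
      have h4 := (hsq.atTop_mul_const (by positivity : 0 < Real.pi / d)).eventually_gt_atTop (|s|)
      filter_upwards [h4, eventually_ge_atTop 1] with n hn hn1
      have h5 := abs_lt.1 hn
      rw [indicator_of_mem (show s ∈ Ioc _ _ from ⟨h5.1, h5.2.le⟩), mul_pow, mul_assoc,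
        ← Complex.exp_nat_mul, ← Complex.exp_add]
      congr 2
      rw [Nat.cast_sub hn1]
      push_cast
      ring
  have hL : ∫ s : ℝ, Complex.exp (-(v / 2 * s ^ 2 : ℝ)) = (√(Real.pi / (v / 2)) : ℝ) := by
    rw [← integral_gaussian, ← integral_complex_ofReal]
    congr 1
    funext s
    push_cast
    ring_nf
  rw [hL] at hlim
  set L := √(Real.pi / (v / 2)) with hLd
  have hL0 : 0 < L := Real.sqrt_pos.2 (by positivity)
  have hlim' := hlim.norm
  rw [Complex.norm_real, Real.norm_of_nonneg hL0.le] at hlim'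
  obtain ⟨N, hN⟩ := eventually_atTop.1 (hlim'.eventually_const_lt (half_lt_self hL0))
  obtain ⟨a, ha, hsmall⟩ := exists_pos_forall_lt_le
    (fun n => coeff (n - 1) (Φ ^ n) * √(n : ℝ)) N
  refine ⟨min a (L / 2 * (d / (2 * Real.pi))), lt_min ha (by positivity), fun n hn hne => ?_⟩
  have hs : 0 < √(n : ℝ) := Real.sqrt_pos.2 (by exact_mod_cast hn)
  have hpos : 0 < coeff (n - 1) (Φ ^ n) := (coeff_pow_nonneg hΦ n _).lt_of_ne hne.symm
  rw [div_le_iff₀ hs]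
  rcases lt_or_ge n N with h | h
  · exact (min_le_left _ _).trans (hsmall n h (mul_pos hpos hs))
  · refine (min_le_right _ _).trans ?_
    have hdj : d ∣ n - 1 := by
      by_contra hdj
      exact hne (coeff_pow_eq_zero_of_not_dvd hd n hdj)
    have h1 := hN n h
    rw [← sqrt_mul_coeff_pow_eq_integral hΦ hΦ1 hd1 hd hn hdj, Complex.norm_real,
      Real.norm_of_nonneg (by positivity)] at h1
    calc L / 2 * (d / (2 * Real.pi))
        ≤ √(n : ℝ) * (2 * Real.pi / d * coeff (n - 1) (Φ ^ n)) * (d / (2 * Real.pi)) := by gcongr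
      _ = _ := by field_simp

end localLimit

section moments

open PowerSeries

variable {p : ℕ → ℝ≥0∞} {ν : ℤ → ℝ≥0∞}

theorem exists_offspring_ne_zero (hp : ∑' k : ℕ, p k = 1)
    (hmean : ∑' k : ℕ, (k : ℝ≥0∞) * p k = 1) (hvar0 : 0 < xiVar p) :
    (p 0).toReal ≠ 0 ∧ ∃ k, k ≠ 0 ∧ (p k).toReal ≠ 0 := by
  have h0 := hasSum_offspring hp
  have h1 := hasSum_offspring_mean hmean
  have htop : ∀ k, p k ≠ ⊤ := fun k => ENNReal.ne_top_of_tsum_ne_top (hp ▸ ENNReal.one_ne_top) k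
  refine ⟨fun hz => hvar0.ne' ?_, ?_⟩
  · have hs : HasSum (fun k : ℕ => ((k : ℝ) - 1) * (p k).toReal) 0 := by
      have := h1.sub h0
      rw [sub_self] at this
      exact this.congr_fun fun k => by ring
    have hnn : ∀ k : ℕ, 0 ≤ ((k : ℝ) - 1) * (p k).toReal := by
      intro k
      rcases k with _ | k
      · simp [hz]
      · push_cast
        rw [add_sub_cancel_right]
        positivity
    have hall := (hasSum_zero_iff_of_nonneg hnn).1 hs
    rw [xiVar, ENNReal.tsum_eq_zero]
    intro k
    rcases mul_eq_zero.1 (congrFun hall k) with h | h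
    · simp [h]
    · rw [(ENNReal.toReal_eq_zero_iff _).1 h |>.resolve_right (htop k), zero_mul]
  · by_contra! hall
    have : (fun k : ℕ => (k : ℝ) * (p k).toReal) = fun _ => 0 := by
      funext k
      rcases eq_or_ne k 0 with rfl | hk
      · simp
      · rw [hall k hk, mul_zero]
    rw [this] at h1
    exact one_ne_zero (h1.unique hasSum_zero)

theorem exists_label_ne (hν : ∑' k : ℤ, ν k = 1)
    (hmean : ∑' k : ℤ, (k : ℝ) * (ν k).toReal = 0) (hvar0 : 0 < etaVar ν) :
    ∃ a b : ℤ, (ν a).toReal ≠ 0 ∧ (ν b).toReal ≠ 0 ∧ a ≠ b := by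
  have h0 : HasSum (fun k => (ν k).toReal) 1 := by
    simpa using hasSum_toReal_of_tsum_eq hν ENNReal.one_ne_top
  have htop : ∀ k, ν k ≠ ⊤ := fun k => ENNReal.ne_top_of_tsum_ne_top (hν ▸ ENNReal.one_ne_top) k
  obtain ⟨a, ha⟩ : ∃ a, (ν a).toReal ≠ 0 := by
    by_contra! hall
    simp only [hall] at h0
    exact one_ne_zero (h0.unique hasSum_zero)
  by_contra! hall
  have hz : ∀ b, b ≠ a → (ν b).toReal = 0 := by
    intro b hb
    by_contra h
    exact hb (hall a b ha h).symm
  rw [tsum_eq_single a fun b hb => by rw [hz b hb, mul_zero]] at hmean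
  have ha0 : (a : ℝ) = 0 := (mul_eq_zero.1 hmean).resolve_right ha
  refine hvar0.ne' ?_
  rw [etaVar, ENNReal.tsum_eq_zero]
  intro k
  rcases eq_or_ne k a with rfl | hk
  · simp [ha0]
  · rw [(ENNReal.toReal_eq_zero_iff _).1 (hz k hk) |>.resolve_right (htop k), zero_mul]

theorem sum_coeff_derivative_offspringSeries_le (hmean : ∑' k : ℕ, (k : ℝ≥0∞) * p k = 1) (N : ℕ) :
    ∑ k ∈ Finset.range N, coeff k (derivative ℝ (offspringSeries p)) ≤ 1 := by
  have h := sum_le_hasSum (Finset.range (N + 1)) (fun k _ => by positivity)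
    (hasSum_offspring_mean hmean)
  rw [Finset.sum_range_succ'] at h
  refine le_trans (Finset.sum_le_sum fun k _ => ?_) ((le_add_of_nonneg_right (by simp)).trans h)
  rw [coeff_derivative, offspringSeries, coeff_mk]
  push_cast
  linarith

theorem sum_coeff_derivative_derivative_offspringSeries_le
    (hmean : ∑' k : ℕ, (k : ℝ≥0∞) * p k = 1) (hvar : xiVar p ≠ ⊤) (N : ℕ) :
    ∑ k ∈ Finset.range N, coeff k (derivative ℝ (derivative ℝ (offspringSeries p))) ≤
      (xiVar p).toReal + 1 := by
  have h := sum_le_hasSum (Finset.range (N + 2)) (fun k _ => by positivity)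
    ((hasSum_offspring_var hvar).add (hasSum_offspring_mean hmean))
  rw [Finset.sum_range_succ', Finset.sum_range_succ'] at h
  rw [add_assoc] at h
  refine le_trans (Finset.sum_le_sum fun k _ => ?_)
    ((le_add_of_nonneg_right (by positivity)).trans h)
  rw [coeff_derivative, coeff_derivative, offspringSeries, coeff_mk]
  push_cast
  have : 0 ≤ (p (k + 1 + 1)).toReal := ENNReal.toReal_nonneg
  have hk : (0 : ℝ) ≤ k := Nat.cast_nonneg k
  nlinarith [mul_nonneg this hk]

theorem exists_secondSeries_le (hp : ∑' k : ℕ, p k = 1)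
    (hmeanp : ∑' k : ℕ, (k : ℝ≥0∞) * p k = 1)
    (hvarp_pos : 0 < xiVar p) (hvarp_fin : xiVar p ≠ ⊤) (hν : ∑' k : ℤ, ν k = 1)
    (hmeanν : ∑' k : ℤ, (k : ℝ) * (ν k).toReal = 0) (hvarν_pos : 0 < etaVar ν)
    (hspanν : ∀ (d : ℕ) (a : ℤ), (∀ k : ℤ, ν k ≠ 0 → (d : ℤ) ∣ (k - a)) → d ≤ 1) :
    ∃ K : ℝ, 0 < K ∧ ∀ n : ℕ, 1 ≤ n → coeff n (sizeSeries p ν) ≠ 0 →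
      ∀ t ∈ Icc (-Real.pi) Real.pi, n * t ^ 4 * coeff n (secondSeries p ν t) ≤
        K * (n ^ 2 * coeff n (sizeSeries p ν)) := by
  have hpi := Real.pi_pos
  have hp1 := hasSum_offspring hp
  have hν1 : HasSum (fun k => (ν k).toReal) 1 := by
    simpa using hasSum_toReal_of_tsum_eq hν ENNReal.one_ne_top
  have hΦ : ∀ n, 0 ≤ coeff n (offspringSeries p) := coeff_offspringSeries_nonneg
  have hΦ1 : HasSum (fun n => coeff n (offspringSeries p)) 1 := by
    simpa only [offspringSeries, coeff_mk] using hp1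
  obtain ⟨hp0, k₁, hk₁, hpk⟩ := exists_offspring_ne_zero hp hmeanp hvarp_pos
  obtain ⟨d, hd1, hd, c, hc0, hc⟩ := exists_norm_latticeCharFun_le
    (w := fun k => coeff k (offspringSeries p)) (x := fun k : ℕ => (k : ℤ)) hΦ hΦ1 (i₀ := 0)
    (i₁ := k₁) (by simpa [offspringSeries] using hp0) (by simpa [offspringSeries] using hpk)
    (by exact_mod_cast hk₁.symm)
  have hd' : ∀ k, coeff k (offspringSeries p) ≠ 0 → d ∣ k := fun k hk => by
    simpa [Int.natCast_dvd_natCast] using hd k hk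
  obtain ⟨a₀, a₁, ha₀, ha₁, hane⟩ := exists_label_ne hν hmeanν hvarν_pos
  obtain ⟨e, he1, he, c', hc'0, hc'⟩ := exists_norm_latticeCharFun_le
    (w := fun k => (ν k).toReal) (x := fun k : ℤ => k) (fun _ => ENNReal.toReal_nonneg) hν1 ha₀ ha₁
    hane
  have htop : ∀ k, ν k ≠ ⊤ := fun k => ENNReal.ne_top_of_tsum_ne_top (hν ▸ ENNReal.one_ne_top) k
  obtain rfl : e = 1 := le_antisymm
    (hspanν e a₀ fun k hk => he k (ENNReal.toReal_ne_zero.2 ⟨hk, htop k⟩)) he1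
  obtain ⟨a, ha0, ha⟩ := exists_div_sqrt_le_coeff_pow hp hmeanp hvarp_pos hvarp_fin hd1 hd' hc0 hc
  set b := d / (2 * Real.pi) * √(Real.pi / c) with hb
  have hb0 : 0 < b := by
    have : (0 : ℝ) < d := by exact_mod_cast hd1
    positivity
  set v := (xiVar p).toReal + 1 with hv
  have hv0 : 0 ≤ v := by positivity
  refine ⟨20 * (1 + v) * b / (c' ^ 2 * a), by positivity, fun n hn hq t ht => ?_⟩
  have hn0 : (0 : ℝ) < n := by exact_mod_cast hn
  have hs : 0 < √(n : ℝ) := Real.sqrt_pos.2 hn0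
  have hqn : ∀ m, 0 ≤ coeff m (sizeSeries p ν) := fun m =>
    (momentBound_tree hν1 t m).hasSum.nonneg (momentBound_tree hν1 t m).nonneg
  rcases eq_or_ne t 0 with rfl | ht0
  · have := hqn n
    rw [zero_pow four_ne_zero, mul_zero, zero_mul]
    positivity
  have hr : ‖labelCharFun ν t‖ ≤ 1 - c' * t ^ 2 := hc' t (by simpa using abs_le.2 ht)
  have ht2 : 0 < c' * t ^ 2 := by positivity
  have hr1 : ‖labelCharFun ν t‖ < 1 := by linarith
  have hD : coeff n (secondSeries p ν t) ≤ 20 * (1 + v) * b / ((1 - ‖labelCharFun ν t‖) ^ 2 * √n) :=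
    (coeff_le_of_quadratic_recursion (B := fun n => b / √(n : ℝ)) constantCoeff_sizeSeries
      (sizeSeries_eq hν1) hqn hΦ (sum_coeff_derivative_offspringSeries_le hmeanp)
      (sum_coeff_derivative_derivative_offspringSeries_le hmeanp hvarp_fin) (norm_nonneg _) hr1.le
      (fun n => by positivity)
      (fun n hn j => coeff_pow_le_div_sqrt hΦ hΦ1.summable hd1 hd' hc0 hc hn j)
      (fun n => by rw [firstSeries, coeff_mk]; exact norm_nonneg _) (coeff_firstSeries_le hν1 t)
      (coeff_secondSeries_le hν1 t) n).trans
      (sum_succ_mul_pow_mul_le (norm_nonneg _) hr1 hb0.le hv0 hn)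
  have hlag : n * coeff n (sizeSeries p ν) = coeff (n - 1) (offspringSeries p ^ n) := by
    simpa using natCast_mul_coeff_pow constantCoeff_sizeSeries (sizeSeries_eq (p := p) hν1) n 1
      (n - 1) (by omega)
  have hA : a / √(n : ℝ) ≤ n * coeff n (sizeSeries p ν) :=
    hlag ▸ ha n hn (hlag ▸ mul_ne_zero hn0.ne' hq)
  have hsq : (c' * t ^ 2) ^ 2 ≤ (1 - ‖labelCharFun ν t‖) ^ 2 := by gcongr; linarith
  calc n * t ^ 4 * coeff n (secondSeries p ν t)
      ≤ n * t ^ 4 * (20 * (1 + v) * b / ((c' * t ^ 2) ^ 2 * √n)) := by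
        gcongr
        refine hD.trans ?_
        gcongr
    _ = 20 * (1 + v) * b / (c' ^ 2 * a) * (n * (a / √(n : ℝ))) := by
        field_simp
    _ ≤ 20 * (1 + v) * b / (c' ^ 2 * a) * (n * (n * coeff n (sizeSeries p ν))) := by gcongr
    _ = _ := by ring

theorem coeff_secondSeries_le_sq_mul (hν : HasSum (fun k => (ν k).toReal) 1) (t : ℝ) (n : ℕ) :
    coeff n (secondSeries p ν t) ≤ n ^ 2 * coeff n (sizeSeries p ν) := by
  have h := momentBound_tree (p := p) hν t n
  rw [secondSeries, coeff_mk]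
  refine hasSum_le (fun T => ?_) h.summable_sq.hasSum (h.hasSum.mul_left ((n : ℝ) ^ 2))
  by_cases hT : LTree.size T = n
  · rw [mul_comm]
    have := LTree.norm_charSum_le t T
    rw [hT] at this
    exact mul_le_mul_of_nonneg_right (by gcongr) (h.nonneg T)
  · simp [treeWeight, hT]

theorem gwlProb_ne_top (hp : ∀ k, p k ≠ ⊤) (hν : ∀ k, ν k ≠ ⊤) (T : LTree) :
    gwlProb p ν T ≠ ⊤ := by
  refine ENNReal.mul_ne_top ?_ ?_
  · exact finprod_mem_induction (· ≠ ⊤) ENNReal.one_ne_top (fun _ _ => ENNReal.mul_ne_top)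
      fun _ _ => hp _
  · exact finprod_mem_induction (· ≠ ⊤) ENNReal.one_ne_top (fun _ _ => ENNReal.mul_ne_top)
      fun _ _ => hν _

end moments

/-- Lemma 6 of Devroye–Janson.  With `X(j; T_n)` the vertical profile
of the randomly labelled conditioned Galton–Watson tree,
`E |(1/n) ∑_j X(j; T_n) e^{ijt}|² ≤ C / (1 + n t⁴)` for all `n ≥ 1` and `t ∈ [-π, π]`. -/
theorem profile_charFun_second_moment_le
    (p : ℕ → ℝ≥0∞) (hp : ∑' k : ℕ, p k = 1)
    (hmeanp : ∑' k : ℕ, (k : ℝ≥0∞) * p k = 1)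
    (hvarp_pos : 0 < xiVar p) (hvarp_fin : xiVar p ≠ ⊤)
    (ν : ℤ → ℝ≥0∞) (hν : ∑' k : ℤ, ν k = 1)
    (hmeanν : ∑' k : ℤ, (k : ℝ) * (ν k).toReal = 0)
    (hvarν_pos : 0 < etaVar ν) (hvarν_fin : etaVar ν ≠ ⊤)
    (hspanν : ∀ (d : ℕ) (a : ℤ), (∀ k : ℤ, ν k ≠ 0 → (d : ℤ) ∣ (k - a)) → d ≤ 1) :
    ∃ C : ℝ, 0 < C ∧ ∀ n : ℕ, 1 ≤ n → probSizeL p ν n ≠ 0 → ∀ t ∈ Set.Icc (-Real.pi) Real.pi,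
      (∑' T : LTree, if LTree.size T = n then gwlProb p ν T *
          ENNReal.ofReal
            (‖(1 / (n : ℂ)) * ∑ᶠ j : ℤ, (profile T j : ℂ) * Complex.exp (Complex.I * j * t)‖ ^ 2)
        else 0) / probSizeL p ν n
        ≤ ENNReal.ofReal (C / (1 + n * t ^ 4)) := by
  have hν1 : HasSum (fun k => (ν k).toReal) 1 := by
    simpa using hasSum_toReal_of_tsum_eq hν ENNReal.one_ne_top
  obtain ⟨K, hK0, hK⟩ := exists_secondSeries_le hp hmeanp hvarp_pos hvarp_fin hν hmeanν hvarν_pos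
    hspanν
  have hfin : ∀ T, gwlProb p ν T ≠ ⊤ := gwlProb_ne_top
    (fun k => ENNReal.ne_top_of_tsum_ne_top (hp ▸ ENNReal.one_ne_top) k)
    (fun k => ENNReal.ne_top_of_tsum_ne_top (hν ▸ ENNReal.one_ne_top) k)
  refine ⟨1 + K, by positivity, fun n hn hne t ht => ?_⟩
  have hn0 : (0 : ℝ) < n := by exact_mod_cast hn
  have hM := momentBound_tree (p := p) hν1 t n
  set q := PowerSeries.coeff n (sizeSeries p ν) with hq
  set D := PowerSeries.coeff n (secondSeries p ν t) with hD
  have hden : probSizeL p ν n = ENNReal.ofReal q := by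
    rw [← hM.hasSum.tsum_eq, ENNReal.ofReal_tsum_of_nonneg hM.nonneg hM.hasSum.summable, probSizeL]
    refine tsum_congr fun T => ?_
    rw [treeWeight]
    split_ifs
    · exact (ENNReal.ofReal_toReal (hfin T)).symm
    · simp
  have hnum : (∑' T : LTree, if LTree.size T = n then gwlProb p ν T *
          ENNReal.ofReal
            (‖(1 / (n : ℂ)) * ∑ᶠ j : ℤ, (profile T j : ℂ) * Complex.exp (Complex.I * j * t)‖ ^ 2)
        else 0) = ENNReal.ofReal (D / n ^ 2) := by
    rw [hD, secondSeries, PowerSeries.coeff_mk, ← tsum_div_const, ENNReal.ofReal_tsum_of_nonneg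
      (fun T => by have := hM.nonneg T; positivity) (hM.summable_sq.div_const _)]
    refine tsum_congr fun T => ?_
    rw [LTree.finsum_profile, treeWeight]
    split_ifs
    · rw [mul_div_assoc, ENNReal.ofReal_mul ENNReal.toReal_nonneg, ENNReal.ofReal_toReal (hfin T),
        norm_mul, norm_div, norm_one, Complex.norm_natCast, mul_pow, div_pow, one_pow,
        one_div_mul_eq_div]
    · simp
  have hq0 : 0 < q := by
    by_contra h
    exact hne (hden.trans (ENNReal.ofReal_eq_zero.2 (not_lt.1 h)))
  rw [hnum, hden, ← ENNReal.ofReal_div_of_pos hq0]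
  refine ENNReal.ofReal_le_ofReal ?_
  rw [div_div, div_le_div_iff₀ (by positivity) (by positivity)]
  have h1 := hK n hn hq0.ne' t ht
  have h2 := coeff_secondSeries_le_sq_mul (p := p) hν1 t n
  linarith
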